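/- arXiv:1410.4753 — 3 statements merged into one kernel-verified Lean document; each statement's English description precedes it below -/
import Mathlib

section
/- Let (X,T) be a compact Hausdorff CP dynamical system (every recurrent point is periodic). If (x_i)_{i∈ℕ} is an infinite sequence in X with x_i ∈ R_T(x_{i+1}) for all i, then x_1 is a periodic point and every x_i lies in the orbit {T^n x_1 : n ∈ ℤ}. -/
open Filter Topology

/-- The `n`-th iterate (for `n : ℤ`) of a homeomorphism `T`. -/
def hIter {X : Type*} [TopologicalSpace X] (T : X ≃ₜ X) (n : ℤ) : X → X :=
  fun x => (T.toEquiv ^ n) x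

/-- The ω-limit set of `x`: cluster points of `(Tⁿ x)` as `n → +∞`. -/
def omegaSet {X : Type*} [TopologicalSpace X] (T : X ≃ₜ X) (x : X) : Set X :=
  {y | MapClusterPt y (atTop : Filter ℤ) fun n : ℤ => hIter T n x}

/-- The α-limit set of `x`: cluster points of `(Tⁿ x)` as `n → −∞`. -/
def alphaSet {X : Type*} [TopologicalSpace X] (T : X ≃ₜ X) (x : X) : Set X :=
  {y | MapClusterPt y (atBot : Filter ℤ) fun n : ℤ => hIter T n x}

/-- The limit relation `R_T(x) = ωT(x) ∪ αT(x)`. -/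
def limitSet {X : Type*} [TopologicalSpace X] (T : X ≃ₜ X) (x : X) : Set X :=
  omegaSet T x ∪ alphaSet T x

section iterates

variable {X : Type*} [TopologicalSpace X] (T : X ≃ₜ X)

lemma hIter_add (m n : ℤ) (x : X) : hIter T (m + n) x = hIter T m (hIter T n x) := by
  simp [hIter, zpow_add]

lemma hIter_zero (x : X) : hIter T 0 x = x := by
  simp [hIter]

lemma continuous_hIter (n : ℤ) : Continuous (hIter T n) := by
  have h : hIter T n = ⇑(T ^ n) := by
    let φ : (X ≃ₜ X) →* Equiv.Perm X :=
      { toFun := Homeomorph.toEquiv, map_one' := rfl, map_mul' := fun _ _ => rfl }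
    funext x
    exact congrArg (fun e : Equiv.Perm X => e x) (map_zpow φ T n).symm
  exact h ▸ (T ^ n).continuous

lemma hIter_mul_eq_self {n : ℤ} {x : X} (h : hIter T n x = x) (k : ℤ) :
    hIter T (n * k) x = x := by
  have h' : (T.toEquiv ^ n) x = x := h
  change (T.toEquiv ^ (n * k)) x = x
  rw [zpow_mul]
  exact Equiv.Perm.zpow_apply_eq_self_of_apply_eq_self h' k

/-- The point `x` is periodic under `T`. -/
def IsHIterPeriodic (x : X) : Prop :=
  ∃ n : ℕ, 1 ≤ n ∧ hIter T (n : ℤ) x = x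

variable {T}

lemma IsHIterPeriodic.hIter {x : X} (h : IsHIterPeriodic T x) (m : ℤ) :
    IsHIterPeriodic T (hIter T m x) := by
  obtain ⟨n, hn, hx⟩ := h
  exact ⟨n, hn, by rw [← hIter_add, add_comm, hIter_add, hx]⟩

lemma isHIterPeriodic_hIter_iff {x : X} {m : ℤ} :
    IsHIterPeriodic T (hIter T m x) ↔ IsHIterPeriodic T x := by
  refine ⟨fun h => ?_, fun h => h.hIter m⟩
  simpa [← hIter_add, hIter_zero] using h.hIter (-m)

lemma IsHIterPeriodic.finite_orbit {x : X} (h : IsHIterPeriodic T x) :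
    (Set.range fun m : ℤ => _root_.hIter T m x).Finite := by
  obtain ⟨n, hn, hx⟩ := h
  refine ((Set.finite_Ico (0 : ℤ) n).image fun m => _root_.hIter T m x).subset ?_
  rintro _ ⟨m, rfl⟩
  have hn' : (0 : ℤ) < n := by exact_mod_cast hn
  refine ⟨m % n, ⟨Int.emod_nonneg m hn'.ne', Int.emod_lt_of_pos m hn'⟩, ?_⟩
  conv_rhs => rw [← Int.emod_add_mul_ediv m n]
  simp only [hIter_add, hIter_mul_eq_self T hx]

lemma mem_of_mem_limitSet {C : Set X} (hC : IsClosed C) {x y : X}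
    (hx : ∀ m : ℤ, hIter T m x ∈ C) (hy : y ∈ limitSet T x) : y ∈ C := by
  by_contra hyC
  have hev : ∀ᶠ z in 𝓝 y, z ∉ C := hC.isOpen_compl.mem_nhds hyC
  rcases hy with hy | hy
  · obtain ⟨m, hm⟩ := (MapClusterPt.frequently hy hev).exists
    exact hm (hx m)
  · obtain ⟨m, hm⟩ := (MapClusterPt.frequently hy hev).exists
    exact hm (hx m)

lemma IsHIterPeriodic.exists_eq_of_mem_limitSet [T2Space X] {x y : X}
    (h : IsHIterPeriodic T x) (hy : y ∈ limitSet T x) : ∃ m : ℤ, y = _root_.hIter T m x := by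
  obtain ⟨m, hm⟩ := mem_of_mem_limitSet h.finite_orbit.isClosed (fun m => ⟨m, rfl⟩) hy
  exact ⟨m, hm.symm⟩

lemma exists_lt_hIter_mem_of_mem_limitSet {x y : X} (hy : y ∈ limitSet T x) {U : Set X}
    (hU : U ∈ 𝓝 y) : ∃ a b : ℤ, a < b ∧ hIter T a x ∈ U ∧ hIter T b x ∈ U := by
  rcases hy with hy | hy
  · have hf := MapClusterPt.frequently hy hU
    obtain ⟨a, ha⟩ := hf.exists
    obtain ⟨b, hb, hab⟩ := (hf.and_eventually (eventually_gt_atTop a)).exists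
    exact ⟨a, b, hab, ha, hb⟩
  · have hf := MapClusterPt.frequently hy hU
    obtain ⟨b, hb⟩ := hf.exists
    obtain ⟨a, ha, hab⟩ := (hf.and_eventually (eventually_lt_atBot b)).exists
    exact ⟨a, b, hab, ha, hb⟩

/-- If every member of a decreasing sequence of nonempty closed sets is entered at some positive
time by a later member, while the return times to the `k`-th set exceed `k`, then the intersection
of the sequence contains a recurrent point. -/
lemma exists_mem_iInter_mem_limitSet [CompactSpace X] [T2Space X] {A : ℕ → Set X}
    (hclosed : ∀ k, IsClosed (A k)) (hne : ∀ k, (A k).Nonempty) (hanti : Antitone A)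
    (hret : ∀ k, ∃ n : ℕ, 1 ≤ n ∧ ∃ l, ∀ y ∈ A l, hIter T (n : ℤ) y ∈ A k)
    (hdisj : ∀ k j : ℕ, 1 ≤ j → j ≤ k → ∀ y ∈ A k, hIter T (j : ℤ) y ∉ A k) :
    ∃ w ∈ ⋂ k, A k, w ∈ limitSet T w := by
  let D : ℕ → Set ℕ := fun k => {n | 1 ≤ n ∧ ∃ l, ∀ y ∈ A l, hIter T (n : ℤ) y ∈ A k}
  have hD_lt : ∀ k, ∀ n ∈ D k, k < n := by
    rintro k n ⟨hn, l, hl⟩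
    by_contra! hnk
    obtain ⟨y, hy⟩ := hne (max k l)
    exact hdisj k n hn hnk y (hanti (le_max_left _ _) hy) (hl y (hanti (le_max_right _ _) hy))
  have hD_anti : Antitone D := by
    rintro k k' hk n ⟨hn, l, hl⟩
    exact ⟨hn, l, fun y hy => hanti hk (hl y hy)⟩
  let F : ℕ → Set (X → X) := fun k => (fun n : ℕ => hIter T (n : ℤ)) '' D k
  have hF_ne : ∀ k, (F k).Nonempty := fun k => Set.Nonempty.image _ (hret k)
  let S : Set (X → X) := ⋂ k, closure (F k)
  have hS_ne : S.Nonempty :=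
    IsCompact.nonempty_iInter_of_sequence_nonempty_isCompact_isClosed _
      (fun k => closure_mono (Set.image_mono (hD_anti k.le_succ)))
      (fun k => (hF_ne k).closure) isClosed_closure.isCompact (fun _ => isClosed_closure)
  have hS_compact : IsCompact S := (isClosed_iInter fun _ => isClosed_closure).isCompact
  have hS_comp : ∀ f ∈ S, ∀ g ∈ S, f ∘ g ∈ S := by
    intro f hf g hg
    refine Set.mem_iInter.2 fun k => ?_
    have hright : Continuous fun h : X → X => h ∘ g :=
      continuous_pi fun x => continuous_apply (g x)
    refine closure_minimal ?_ (isClosed_closure.preimage hright) (Set.mem_iInter.1 hf k)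
    rintro _ ⟨n, ⟨hn, l, hl⟩, rfl⟩
    have hleft : Continuous fun h : X → X => hIter T (n : ℤ) ∘ h :=
      continuous_pi fun x => (continuous_hIter T n).comp (continuous_apply x)
    refine closure_minimal ?_ (isClosed_closure.preimage hleft) (Set.mem_iInter.1 hg l)
    rintro _ ⟨m, ⟨hm, l', hl'⟩, rfl⟩
    refine subset_closure ⟨n + m, ⟨by omega, l', fun y hy => ?_⟩, ?_⟩
    · rw [Nat.cast_add, hIter_add]
      exact hl _ (hl' y hy)
    · funext y
      simp [hIter_add]
  have hS_maps : ∀ f ∈ S, ∀ y ∈ ⋂ k, A k, f y ∈ ⋂ k, A k := by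
    intro f hf y hy
    refine Set.mem_iInter.2 fun k => ?_
    refine closure_minimal ?_ ((hclosed k).preimage (continuous_apply y)) (Set.mem_iInter.1 hf k)
    rintro _ ⟨n, ⟨-, l, hl⟩, rfl⟩
    exact hl y (Set.mem_iInter.1 hy l)
  let : Semigroup (X → X) := { mul := fun f g => f ∘ g, mul_assoc := fun _ _ _ => rfl }
  obtain ⟨u, hu, huu⟩ := exists_idempotent_in_compact_subsemigroup
    (fun g : X → X => continuous_pi fun x => continuous_apply (g x)) S hS_ne hS_compact hS_comp
  obtain ⟨z, hz⟩ : (⋂ k, A k).Nonempty :=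
    IsCompact.nonempty_iInter_of_sequence_nonempty_isCompact_isClosed _
      (fun k => hanti k.le_succ) hne (hclosed 0).isCompact hclosed
  refine ⟨u z, hS_maps u hu z hz, Or.inl ?_⟩
  refine mapClusterPt_atTop_iff_forall_mem_closure.2 fun i => ?_
  have hw : u (u z) = u z := congrFun huu z
  have hmem : u ∈ (fun f : X → X => f (u z)) ⁻¹'
      closure ((fun n : ℤ => hIter T n (u z)) '' Set.Ici i) := by
    refine closure_minimal ?_ (isClosed_closure.preimage (continuous_apply (u z)))
      (Set.mem_iInter.1 hu i.toNat)
    rintro _ ⟨n, hn, rfl⟩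
    have := hD_lt _ n hn
    exact subset_closure ⟨n, by simp only [Set.mem_Ici]; omega, rfl⟩
  rwa [Set.mem_preimage, hw] at hmem

/-- A point that is not periodic has arbitrarily small closed neighbourhoods which do not return
to themselves up to a prescribed time. -/
lemma exists_isClosed_mem_nhds_forall_hIter_notMem [CompactSpace X] [T2Space X] {y : X}
    (hy : ¬ IsHIterPeriodic T y) {U : Set X} (hU : U ∈ 𝓝 y) (k : ℕ) :
    ∃ C ∈ 𝓝 y, IsClosed C ∧ C ⊆ U ∧
      ∀ j : ℕ, 1 ≤ j → j ≤ k → ∀ z ∈ C, hIter T (j : ℤ) z ∉ C := by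
  have hsep : ∀ j ∈ Set.Icc 1 k, ∃ V ∈ 𝓝 y, ∀ z ∈ V, hIter T (j : ℤ) z ∉ V := by
    intro j hj
    have hne : hIter T (j : ℤ) y ≠ y := fun h => hy ⟨j, hj.1, h⟩
    obtain ⟨P, Q, hP, hQ, hPQ⟩ := t2_separation_nhds hne
    refine ⟨Q ∩ hIter T (j : ℤ) ⁻¹' P,
      inter_mem hQ ((continuous_hIter T j).continuousAt.preimage_mem_nhds hP), ?_⟩
    intro z hz hz'
    exact Set.disjoint_left.1 hPQ hz.2 hz'.1
  choose! V hV hVdisj using hsep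
  have hW : U ∩ ⋂ j ∈ Set.Icc 1 k, V j ∈ 𝓝 y :=
    inter_mem hU ((biInter_mem (Set.finite_Icc 1 k)).2 hV)
  obtain ⟨C, hC, hCclosed, hCW⟩ := exists_mem_nhds_isClosed_subset hW
  refine ⟨C, hC, hCclosed, hCW.trans Set.inter_subset_left, fun j hj hjk z hz hzC => ?_⟩
  have hCV : C ⊆ V j := fun x hx => Set.mem_iInter₂.1 (hCW hx).2 j ⟨hj, hjk⟩
  exact hVdisj j ⟨hj, hjk⟩ z (hCV hz) (hCV hzC)

/-- A chain `x i ∈ R_T (x (i + 1))` of points that are not periodic forces the existence of a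
recurrent point that is not periodic. -/
lemma exists_mem_limitSet_not_isHIterPeriodic [CompactSpace X] [T2Space X] {x : ℕ → X}
    (hx : ∀ i, x i ∈ limitSet T (x (i + 1))) (hper : ∀ i, ¬ IsHIterPeriodic T (x i)) :
    ∃ w, w ∈ limitSet T w ∧ ¬ IsHIterPeriodic T w := by
  let P : ℕ → Set X → Prop := fun k C => IsClosed C ∧ (∃ m : ℤ, C ∈ 𝓝 (hIter T m (x k))) ∧
    ∀ j : ℕ, 1 ≤ j → j ≤ k → ∀ z ∈ C, hIter T (j : ℤ) z ∉ C
  have hstep : ∀ k C, P k C → ∃ C', P (k + 1) C' ∧ C' ⊆ C ∧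
      ∃ n : ℕ, 1 ≤ n ∧ ∀ y ∈ C', hIter T (n : ℤ) y ∈ C := by
    rintro k C ⟨-, ⟨m, hm⟩, -⟩
    obtain ⟨a, b, hab, ha, hb⟩ := exists_lt_hIter_mem_of_mem_limitSet (hx k)
      ((continuous_hIter T m).continuousAt.preimage_mem_nhds (interior_mem_nhds.2 hm))
    rw [Set.mem_preimage, ← hIter_add] at ha hb
    obtain ⟨n, hn⟩ := Int.eq_ofNat_of_zero_le (sub_nonneg.2 hab.le)
    have hU : C ∩ hIter T (n : ℤ) ⁻¹' C ∈ 𝓝 (hIter T (m + a) (x (k + 1))) := by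
      refine inter_mem (mem_interior_iff_mem_nhds.1 ha)
        ((continuous_hIter T n).continuousAt.preimage_mem_nhds ?_)
      rw [← hIter_add, show (n : ℤ) + (m + a) = m + b by omega]
      exact mem_interior_iff_mem_nhds.1 hb
    obtain ⟨C', hC', hclosed, hsub, hdisj⟩ := exists_isClosed_mem_nhds_forall_hIter_notMem
      (mt isHIterPeriodic_hIter_iff.1 (hper (k + 1))) hU (k + 1)
    exact ⟨C', ⟨hclosed, ⟨_, hC'⟩, hdisj⟩, fun y hy => (hsub hy).1, n, by omega,
      fun y hy => (hsub hy).2⟩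
  choose! next hP hsub hret using hstep
  let A : ℕ → Set X := fun k => Nat.rec Set.univ next k
  have hA : ∀ k, P k (A k) := by
    intro k
    induction k with
    | zero => exact ⟨isClosed_univ, ⟨0, univ_mem⟩, by omega⟩
    | succ k ih => exact hP k _ ih
  obtain ⟨w, hwA, hw⟩ := exists_mem_iInter_mem_limitSet (T := T) (A := A) (fun k => (hA k).1)
    (fun k => (hA k).2.1.elim fun _ hm => ⟨_, mem_of_mem_nhds hm⟩)
    (antitone_nat_of_succ_le fun k => hsub k _ (hA k))
    (fun k => (hret k _ (hA k)).imp fun n hn => ⟨hn.1, k + 1, hn.2⟩)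
    (fun k => (hA k).2.2)
  refine ⟨w, hw, ?_⟩
  rintro ⟨n, hn, hwn⟩
  have hmem := Set.mem_iInter.1 hwA n
  exact (hA n).2.2 n hn le_rfl w hmem (hwn.symm ▸ hmem)

end iterates

/-- In a compact Hausdorff CP system (every recurrent point is periodic), if `x_i ∈ R_T(x_{i+1})`
for all `i`, then `x_0` is periodic and every `x_i` lies in the orbit of `x_0`. -/
theorem stmt5 {X : Type*} [TopologicalSpace X] [CompactSpace X] [T2Space X] [Nonempty X]
    (T : X ≃ₜ X)
    (hCP : ∀ x : X, x ∈ limitSet T x → ∃ n : ℕ, 1 ≤ n ∧ hIter T (n : ℤ) x = x)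
    (x : ℕ → X) (hx : ∀ i : ℕ, x i ∈ limitSet T (x (i + 1))) :
    (∃ n : ℕ, 1 ≤ n ∧ hIter T (n : ℤ) (x 0) = x 0) ∧
    ∀ i : ℕ, ∃ m : ℤ, x i = hIter T m (x 0) := by
  have hback : ∀ i, IsHIterPeriodic T (x (i + 1)) → IsHIterPeriodic T (x i) := by
    intro i h
    obtain ⟨m, hm⟩ := h.exists_eq_of_mem_limitSet (hx i)
    exact hm ▸ h.hIter m
  have hper : ∀ i, IsHIterPeriodic T (x i) := by
    by_contra! hN
    obtain ⟨N, hN⟩ := hN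
    have htail : ∀ i, ¬ IsHIterPeriodic T (x (N + i)) := by
      intro i
      induction i with
      | zero => exact hN
      | succ i ih => exact fun h => ih (hback _ h)
    obtain ⟨w, hw, hw'⟩ := exists_mem_limitSet_not_isHIterPeriodic
      (x := fun i => x (N + i)) (fun i => hx (N + i)) htail
    exact hw' (hCP w hw)
  refine ⟨hper 0, fun i => ?_⟩
  induction i with
  | zero => exact ⟨0, (hIter_zero T _).symm⟩
  | succ i ih =>
    obtain ⟨m, hm⟩ := ih
    obtain ⟨k, hk⟩ := (hper (i + 1)).exists_eq_of_mem_limitSet (hx i)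
    refine ⟨-k + m, ?_⟩
    rw [hIter_add, ← hm, hk, ← hIter_add, neg_add_cancel, hIter_zero]
end

section
/- With the standing labeled-subshift setup, let 𝓜 be a label. If 𝓜 is not of finite type, then X(𝓜) and X₊(𝓜) each contain a recurrent point that is not periodic. If 𝓜 is of finite type, then e = χ(∅) is the only recurrent point of X(𝓜) and of X₊(𝓜); in that case (X(𝓜),S) and (X₊(𝓜),S) are topologically transitive, locally equicontinuous, and, provided 𝓜 ≠ ∅, not weakly mixing. -/
open Filter Topology

/-- `k : ℤ → ℤ` is `b`-expanding: `k(−n) = −k(n)` and `k(n+1) > b·Σ_{i=0}^{n} k(i)` for all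
`n ≥ 0`. -/
def IsExpanding (b : ℕ) (k : ℤ → ℤ) : Prop :=
  (∀ n : ℤ, k (-n) = - k n) ∧
  ∀ n : ℕ, (b : ℤ) * ∑ i ∈ Finset.range (n + 1), k (i : ℤ) < k ((n : ℤ) + 1)

/-- `j : Fin r → ℤ` is an expansion of `t`: nonzero entries with strictly decreasing absolute
values whose `k`-values sum to `t`. -/
def IsExpansion (k : ℤ → ℤ) (t : ℤ) (r : ℕ) (j : Fin r → ℤ) : Prop :=
  (∀ i : Fin r, j i ≠ 0) ∧ (∀ i₁ i₂ : Fin r, i₁ < i₂ → |j i₂| < |j i₁|) ∧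
  t = ∑ i : Fin r, k (j i)

/-- `IP(k)`: the set of sums of finite subsets of the image set `k(ℤ)`. -/
def IPk (k : ℤ → ℤ) : Set ℤ :=
  {t | ∃ F : Finset ℤ, ↑F ⊆ Set.range k ∧ t = ∑ x ∈ F, x}

/-- `IP₊(k)`: the set of sums of finite subsets of the image set `k(ℕ)` (positive arguments). -/
def IPkP (k : ℤ → ℤ) : Set ℤ :=
  {t | ∃ F : Finset ℤ, ↑F ⊆ k '' {j : ℤ | 0 < j} ∧ t = ∑ x ∈ F, x}

/-- A label: a hereditary set of ℕ-vectors (finitely supported functions `ℕ → ℕ`). -/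
def IsLabel (M : Set (ℕ →₀ ℕ)) : Prop :=
  ∀ m₁ m : ℕ →₀ ℕ, m₁ ≤ m → m ∈ M → m₁ ∈ M

/-- `𝓜 − r = {w : w + r ∈ 𝓜}`. -/
def Msub (M : Set (ℕ →₀ ℕ)) (r : ℕ →₀ ℕ) : Set (ℕ →₀ ℕ) := {w | w + r ∈ M}

/-- Specification of the partition data: each `D ℓ` is infinite, the `D ℓ` are pairwise
disjoint, and `lab n` is the index of the cell containing `n` (so the `D ℓ` cover `ℕ`). -/
def PartitionSpec (D : ℕ → Set ℕ) (lab : ℕ → ℕ) : Prop :=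
  (∀ ℓ : ℕ, (D ℓ).Infinite) ∧ (∀ ℓ₁ ℓ₂ : ℕ, ℓ₁ ≠ ℓ₂ → D ℓ₁ ∩ D ℓ₂ = ∅) ∧
  (∀ n : ℕ, n ∈ D (lab n))

/-- Specification that `R t` is the length vector `𝐫(t)` of the (unique) expansion of each
expanding time `t`. -/
def LengthVecSpec (k : ℤ → ℤ) (lab : ℕ → ℕ) (R : ℤ → ℕ →₀ ℕ) : Prop :=
  ∀ (t : ℤ) (r : ℕ) (j : Fin r → ℤ), IsExpansion k t r j →
    R t = ∑ i : Fin r, Finsupp.single (lab (j i).natAbs) 1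

/-- `A[𝓜] = {t ∈ IP(k) : 𝐫(t) ∈ 𝓜}`. -/
def setA (k : ℤ → ℤ) (R : ℤ → ℕ →₀ ℕ) (M : Set (ℕ →₀ ℕ)) : Set ℤ :=
  {t | t ∈ IPk k ∧ R t ∈ M}

/-- `A₊[𝓜] = A[𝓜] ∩ IP₊(k)`. -/
def setAP (k : ℤ → ℤ) (R : ℤ → ℕ →₀ ℕ) (M : Set (ℕ →₀ ℕ)) : Set ℤ :=
  setA k R M ∩ IPkP k

/-- The indicator point `χ(A) ∈ {0,1}^ℤ` of a set `A ⊆ ℤ`. -/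
noncomputable def chiB (A : Set ℤ) : ℤ → Bool :=
  fun t => @decide (t ∈ A) (Classical.propDecidable _)

/-- `x[𝓜] = χ(A[𝓜])`. -/
noncomputable def xL (k : ℤ → ℤ) (R : ℤ → ℕ →₀ ℕ) (M : Set (ℕ →₀ ℕ)) : ℤ → Bool :=
  chiB (setA k R M)

/-- `x₊[𝓜] = χ(A₊[𝓜])`. -/
noncomputable def xLP (k : ℤ → ℤ) (R : ℤ → ℕ →₀ ℕ) (M : Set (ℕ →₀ ℕ)) : ℤ → Bool :=
  chiB (setAP k R M)

/-- The iterated shift `Sⁿ` on `{0,1}^ℤ`: `(Sⁿx)_s = x_{s+n}`. -/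
def shiftZ (n : ℤ) (x : ℤ → Bool) : ℤ → Bool := fun s => x (s + n)

/-- The standard metric on `{0,1}^ℤ`: `d(x,y) = inf {2^{-N} : x_t = y_t for all |t| < N}`. -/
noncomputable def bdist (x y : ℤ → Bool) : ℝ :=
  sInf {r : ℝ | ∃ N : ℕ, (∀ t : ℤ, |t| < (N : ℤ) → x t = y t) ∧ r = (2 : ℝ) ^ (-(N : ℤ))}

/-- A label is of finite type if it contains no strictly increasing infinite sequence. -/
def FiniteType (M : Set (ℕ →₀ ℕ)) : Prop :=
  ¬ ∃ f : ℕ → (ℕ →₀ ℕ), (∀ i, f i ∈ M) ∧ StrictMono f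

/-- The orbit closure of a point of `{0,1}^ℤ` under the shift. -/
noncomputable def orbitClosure (x : ℤ → Bool) : Set (ℤ → Bool) :=
  closure (Set.range fun n : ℤ => shiftZ n x)

/-- `X(𝓜)`: the orbit closure of `x[𝓜]`. -/
noncomputable def XM (k : ℤ → ℤ) (R : ℤ → ℕ →₀ ℕ) (M : Set (ℕ →₀ ℕ)) : Set (ℤ → Bool) :=
  orbitClosure (xL k R M)

/-- `X₊(𝓜)`: the orbit closure of `x₊[𝓜]`. -/
noncomputable def XMP (k : ℤ → ℤ) (R : ℤ → ℕ →₀ ℕ) (M : Set (ℕ →₀ ℕ)) : Set (ℤ → Bool) :=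
  orbitClosure (xLP k R M)

/-- `x` is a recurrent point for the shift: a cluster point of `(Sⁿ x)` as `n → +∞` or as
`n → −∞`. -/
def RecPt (x : ℤ → Bool) : Prop :=
  MapClusterPt x (atTop : Filter ℤ) (fun n : ℤ => shiftZ n x) ∨
  MapClusterPt x (atBot : Filter ℤ) (fun n : ℤ => shiftZ n x)

/-- `x` is a periodic point for the shift. -/
def PerPt (x : ℤ → Bool) : Prop := ∃ n : ℕ, 1 ≤ n ∧ shiftZ (n : ℤ) x = x

/-- The subsystem on `Z` is topologically transitive: some point of `Z` has dense orbit
in `Z`. -/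
noncomputable def TopTransOn (Z : Set (ℤ → Bool)) : Prop :=
  ∃ x ∈ Z, Z ⊆ orbitClosure x

/-- `x` is an equicontinuity point of the subsystem on `Y` (for the standard metric). -/
noncomputable def EqPtB (Y : Set (ℤ → Bool)) (x : ℤ → Bool) : Prop :=
  ∀ ε > (0 : ℝ), ∃ δ > (0 : ℝ), ∀ y ∈ Y, bdist x y < δ →
    ∀ n : ℤ, bdist (shiftZ n x) (shiftZ n y) < ε

/-- The subsystem on `Z` is locally equicontinuous: every point is an equicontinuity point of
its own orbit closure. -/
noncomputable def LEOn (Z : Set (ℤ → Bool)) : Prop :=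
  ∀ x ∈ Z, EqPtB (orbitClosure x) x

/-- The subsystem on `Z` is weakly mixing: the product system is topologically transitive. -/
def WeakMixOn (Z : Set (ℤ → Bool)) : Prop :=
  ∀ U₁ V₁ U₂ V₂ : Set (ℤ → Bool), IsOpen U₁ → IsOpen V₁ → IsOpen U₂ → IsOpen V₂ →
    (U₁ ∩ Z).Nonempty → (V₁ ∩ Z).Nonempty → (U₂ ∩ Z).Nonempty → (V₂ ∩ Z).Nonempty →
    ∃ n : ℤ, (shiftZ n '' (U₁ ∩ Z) ∩ (V₁ ∩ Z)).Nonempty ∧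
      (shiftZ n '' (U₂ ∩ Z) ∩ (V₂ ∩ Z)).Nonempty

/-- The integer `∑ᵢ cᵢ Kᵢ` with digits `c` in the base `K`. -/
noncomputable def digitVal (K : ℕ → ℤ) : (ℕ →₀ ℤ) →ₗ[ℤ] ℤ := Finsupp.linearCombination ℤ K

/-- The length vector of a digit sequence whose `i`-th place carries the label `L i`. -/
noncomputable def digitVec (L : ℕ → ℕ) (c : ℕ →₀ ℤ) : ℕ →₀ ℕ :=
  c.sum fun i a => Finsupp.single (L i) a.natAbs

/-- The integers with digits in `C` whose length vector belongs to `M`. -/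
def digitSums (K : ℕ → ℤ) (L : ℕ → ℕ) (C : Set ℤ) (M : Set (ℕ →₀ ℕ)) : Set ℤ :=
  {t | ∃ c : ℕ →₀ ℤ, (∀ i, c i ∈ C) ∧ digitVec L c ∈ M ∧ digitVal K c = t}

theorem digitVal_eq_sum_range (K : ℕ → ℤ) {c : ℕ →₀ ℤ} {n : ℕ} (hc : ∀ i, n ≤ i → c i = 0) :
    digitVal K c = ∑ i ∈ Finset.range n, c i * K i := by
  rw [digitVal, Finsupp.linearCombination_apply, Finsupp.sum]
  refine Finset.sum_subset ?_ ?_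
  · intro i hi
    by_contra h
    exact (Finsupp.mem_support_iff.1 hi) (hc i (by simpa using h))
  · intro i _ hi
    simp [Finsupp.notMem_support_iff.1 hi]

theorem digitVec_add (L : ℕ → ℕ) {c d : ℕ →₀ ℤ} (h : Disjoint c.support d.support) :
    digitVec L (c + d) = digitVec L c + digitVec L d :=
  Finsupp.sum_add_index_of_disjoint h _

theorem sum_nonneg_of_growth {K : ℕ → ℤ} (hK : ∀ n, 3 * ∑ i ∈ Finset.range n, K i < K n) (n : ℕ) :
    0 ≤ ∑ i ∈ Finset.range n, K i := by
  induction n with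
  | zero => simp
  | succ n ih => rw [Finset.sum_range_succ]; linarith [hK n]

theorem pos_of_growth {K : ℕ → ℤ} (hK : ∀ n, 3 * ∑ i ∈ Finset.range n, K i < K n) (n : ℕ) :
    0 < K n := by
  linarith [hK n, sum_nonneg_of_growth hK n]

theorem sum_mono_of_growth {K : ℕ → ℤ} (hK : ∀ n, 3 * ∑ i ∈ Finset.range n, K i < K n) :
    Monotone fun n => ∑ i ∈ Finset.range n, K i :=
  monotone_nat_of_le_succ fun n => by
    simp only [Finset.sum_range_succ]; linarith [pos_of_growth hK n]

theorem le_sum_of_growth {K : ℕ → ℤ} (hK : ∀ n, 3 * ∑ i ∈ Finset.range n, K i < K n) (n : ℕ) :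
    (n : ℤ) ≤ ∑ i ∈ Finset.range n, K i := by
  induction n with
  | zero => simp
  | succ n ih =>
    rw [Finset.sum_range_succ]; push_cast; linarith [Int.add_one_le_iff.2 (pos_of_growth hK n)]

theorem exists_le_sum_of_growth {K : ℕ → ℤ}
    (hK : ∀ n, 3 * ∑ i ∈ Finset.range n, K i < K n) (a : ℤ) (m : ℕ) :
    ∃ n, m ≤ n ∧ a ≤ ∑ i ∈ Finset.range n, K i := by
  refine ⟨max m a.natAbs, le_max_left _ _, le_trans ?_ (le_sum_of_growth hK _)⟩
  have := le_max_right m a.natAbs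
  omega

theorem abs_sum_range_le {K : ℕ → ℤ} (hK : ∀ n, 3 * ∑ i ∈ Finset.range n, K i < K n)
    {d : ℕ → ℤ} {B : ℤ} (hd : ∀ i, |d i| ≤ B) (n : ℕ) :
    |∑ i ∈ Finset.range n, d i * K i| ≤ B * ∑ i ∈ Finset.range n, K i := by
  rw [Finset.mul_sum]
  refine (Finset.abs_sum_le_sum_abs _ _).trans (Finset.sum_le_sum fun i _ => ?_)
  rw [abs_mul, abs_of_pos (pos_of_growth hK i)]
  exact mul_le_mul_of_nonneg_right (hd i) (pos_of_growth hK i).le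

theorem abs_digitVal_le {K : ℕ → ℤ} (hK : ∀ n, 3 * ∑ i ∈ Finset.range n, K i < K n)
    {d : ℕ →₀ ℤ} {B : ℤ} (hd : ∀ i, |d i| ≤ B) {n : ℕ} (hn : ∀ i, n ≤ i → d i = 0) :
    |digitVal K d| ≤ B * ∑ i ∈ Finset.range n, K i := by
  rw [digitVal_eq_sum_range K hn]
  exact abs_sum_range_le hK hd n

theorem digit_eq_zero_of_abs_digitVal_le {K : ℕ → ℤ}
    (hK : ∀ n, 3 * ∑ i ∈ Finset.range n, K i < K n)
    {d : ℕ →₀ ℤ} {B : ℤ} (hB : B ≤ 3) (hd : ∀ i, |d i| ≤ B) {n : ℕ}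
    (hn : |digitVal K d| ≤ (3 - B) * ∑ i ∈ Finset.range n, K i) :
    ∀ i, n ≤ i → d i = 0 := by
  intro i hi
  by_contra hne
  have hi' : i ∈ d.support := Finsupp.mem_support_iff.2 hne
  set m := d.support.max' ⟨i, hi'⟩ with hm
  have hmd : d m ≠ 0 := Finsupp.mem_support_iff.1 (Finset.max'_mem _ _)
  have him : i ≤ m := Finset.le_max' _ _ hi'
  have hval : digitVal K d = ∑ j ∈ Finset.range (m + 1), d j * K j := by
    refine digitVal_eq_sum_range K fun j hj => ?_
    by_contra h
    have := Finset.le_max' _ _ (Finsupp.mem_support_iff.2 h)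
    omega
  rw [Finset.sum_range_succ] at hval
  have h1 := abs_sum_range_le hK hd m
  have h2 : K m ≤ |d m * K m| := by
    rw [abs_mul, abs_of_pos (pos_of_growth hK m)]
    nlinarith [Int.one_le_abs hmd, pos_of_growth hK m]
  have h3 : |d m * K m| ≤ |digitVal K d| + |∑ j ∈ Finset.range m, d j * K j| := by
    have : d m * K m = digitVal K d - ∑ j ∈ Finset.range m, d j * K j := by rw [hval]; ring
    rw [this]
    exact abs_sub _ _
  have h4 : ∑ j ∈ Finset.range n, K j ≤ ∑ j ∈ Finset.range m, K j :=
    sum_mono_of_growth hK (hi.trans him)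
  nlinarith [hK m]

theorem digit_eq_of_abs_sub_le {K : ℕ → ℤ} (hK : ∀ n, 3 * ∑ i ∈ Finset.range n, K i < K n)
    {c d : ℕ →₀ ℤ} (hc : ∀ i, |c i| ≤ 1) (hd : ∀ i, |d i| ≤ 1) {n : ℕ}
    (hn : |digitVal K c - digitVal K d| ≤ ∑ i ∈ Finset.range n, K i) :
    ∀ i, n ≤ i → c i = d i := by
  intro i hi
  rw [← map_sub] at hn
  have := digit_eq_zero_of_abs_digitVal_le hK (d := c - d) (B := 2) (by norm_num)
    (fun i => by
      have h1 := hc i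
      have h2 := hd i
      rw [Finsupp.sub_apply]
      linarith [abs_sub (c i) (d i)]) (n := n) (by linarith) i hi
  rw [Finsupp.sub_apply] at this
  linarith

theorem digitVal_injective_of_growth {K : ℕ → ℤ}
    (hK : ∀ n, 3 * ∑ i ∈ Finset.range n, K i < K n)
    {c d : ℕ →₀ ℤ} (hc : ∀ i, |c i| ≤ 1) (hd : ∀ i, |d i| ≤ 1)
    (h : digitVal K c = digitVal K d) : c = d := by
  ext i
  exact digit_eq_of_abs_sub_le hK hc hd (n := 0) (by simp [h]) i (Nat.zero_le _)

/-- Integers with digits in `{-1, 0, 1}` contain no long progression of a given step. -/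
theorem exists_progression_not_mem {K : ℕ → ℤ} (hK : ∀ n, 3 * ∑ i ∈ Finset.range n, K i < K n)
    {p : ℤ} (hp : p ≠ 0) :
    ∃ N : ℕ, ∀ t : ℤ, ∃ j ≤ N, ∀ c : ℕ →₀ ℤ, (∀ i, |c i| ≤ 1) → digitVal K c ≠ j * p + t := by
  obtain ⟨n, -, hn⟩ := exists_le_sum_of_growth hK |p| 0
  refine ⟨(2 * ∑ i ∈ Finset.range n, K i + 1).toNat, fun t => ?_⟩
  by_contra! H
  choose! c hc hv using H
  have key : ∀ j : ℕ, j ≤ (2 * ∑ i ∈ Finset.range n, K i + 1).toNat →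
      ∀ i, n ≤ i → c j i = c 0 i := by
    intro j
    induction j with
    | zero => intros; rfl
    | succ j ih =>
      intro hj i hi
      rw [← ih (by omega) i hi]
      refine digit_eq_of_abs_sub_le hK (hc _ hj) (hc _ (by omega)) ?_ i hi
      rw [hv _ hj, hv _ (by omega)]
      convert hn using 2
      push_cast
      ring
  set N := (2 * ∑ i ∈ Finset.range n, K i + 1).toNat with hN
  have h1 := abs_digitVal_le hK (d := c N - c 0) (B := 2) (fun i => by
      have h1 := hc N le_rfl i
      have h2 := hc 0 (Nat.zero_le _) i
      rw [Finsupp.sub_apply]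
      linarith [abs_sub (c N i) (c 0 i)]) (n := n) (fun i hi => by
      rw [Finsupp.sub_apply, key N le_rfl i hi, sub_self])
  rw [map_sub, hv _ le_rfl, hv _ (Nat.zero_le _)] at h1
  have h2 : (N : ℤ) * p + t - (((0 : ℕ) : ℤ) * p + t) = N * p := by push_cast; ring
  rw [h2, abs_mul, abs_of_nonneg (Int.natCast_nonneg N)] at h1
  have h3 : (N : ℤ) = 2 * ∑ i ∈ Finset.range n, K i + 1 :=
    Int.toNat_of_nonneg (by linarith [sum_nonneg_of_growth hK n])
  nlinarith [Int.one_le_abs hp]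

/-- Integers with digits in `{-1, 0, 1}` leave arbitrarily long gaps. -/
theorem exists_gap {K : ℕ → ℤ} (hK : ∀ n, 3 * ∑ i ∈ Finset.range n, K i < K n) (N : ℤ) :
    ∃ t : ℤ, ∀ s, |s| ≤ N → ∀ c : ℕ →₀ ℤ, (∀ i, |c i| ≤ 1) → digitVal K c ≠ s + t := by
  obtain ⟨n, -, hn⟩ := exists_le_sum_of_growth hK (2 * N + 1) 0
  refine ⟨∑ i ∈ Finset.range n, K i + N + 1, fun s hs c hc hv => ?_⟩
  obtain ⟨hs1, hs2⟩ := abs_le.1 hs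
  have h1 := abs_digitVal_le hK hc (digit_eq_zero_of_abs_digitVal_le hK (by norm_num) hc (n := n)
    (by rw [hv, abs_le]; constructor <;> linarith))
  rw [hv] at h1
  linarith [le_abs_self (s + (∑ i ∈ Finset.range n, K i + N + 1))]

theorem tendsto_shiftZ_iff {U : Filter ℤ} {x y : ℤ → Bool} :
    Tendsto (fun n => shiftZ n x) U (𝓝 y) ↔ ∀ s, ∀ᶠ t in U, x (s + t) = y s := by
  simp only [tendsto_pi_nhds, nhds_discrete, tendsto_pure, shiftZ]

theorem continuous_shiftZ (n : ℤ) : Continuous (shiftZ n) :=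
  continuous_pi fun s => continuous_apply (s + n)

theorem shiftZ_shiftZ (m n : ℤ) (x : ℤ → Bool) : shiftZ m (shiftZ n x) = shiftZ (m + n) x := by
  funext s
  simp only [shiftZ, add_assoc]

theorem shiftZ_zero (x : ℤ → Bool) : shiftZ 0 x = x := by
  funext s
  simp only [shiftZ, add_zero]

theorem mem_closure_image_shiftZ_iff {x y : ℤ → Bool} {T : Set ℤ} :
    y ∈ closure ((fun n => shiftZ n x) '' T) ↔
      ∃ U : Ultrafilter ℤ, T ∈ U ∧ ∀ s, ∀ᶠ t in U, x (s + t) = y s := by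
  have : y ∈ closure ((fun n => shiftZ n x) '' T) ↔
      MapClusterPt y (𝓟 T) (fun n => shiftZ n x) := by
    rw [mem_closure_iff_clusterPt, MapClusterPt, map_principal]
  rw [this, mapClusterPt_iff_ultrafilter]
  simp only [tendsto_shiftZ_iff, le_principal_iff, Ultrafilter.mem_coe]

theorem mem_orbitClosure_iff {x y : ℤ → Bool} :
    y ∈ orbitClosure x ↔ ∃ U : Ultrafilter ℤ, ∀ s, ∀ᶠ t in U, x (s + t) = y s := by
  rw [orbitClosure, ← Set.image_univ, mem_closure_image_shiftZ_iff]
  exact exists_congr fun U => and_iff_right univ_mem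

theorem self_mem_orbitClosure (x : ℤ → Bool) : x ∈ orbitClosure x :=
  subset_closure ⟨0, shiftZ_zero x⟩

theorem recPt_iff {x : ℤ → Bool} :
    RecPt x ↔ ∃ U : Ultrafilter ℤ, (U : Filter ℤ) ≤ cofinite ∧
      ∀ s, ∀ᶠ t in U, x (s + t) = x s := by
  simp only [RecPt, mapClusterPt_iff_ultrafilter, tendsto_shiftZ_iff, Int.cofinite_eq,
    Ultrafilter.le_sup_iff]
  constructor
  · rintro (⟨U, h, h'⟩ | ⟨U, h, h'⟩)
    exacts [⟨U, Or.inr h, h'⟩, ⟨U, Or.inl h, h'⟩]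
  · rintro ⟨U, h | h, h'⟩
    exacts [Or.inr ⟨U, h, h'⟩, Or.inl ⟨U, h, h'⟩]

theorem RecPt.of_shiftZ {a : ℤ} {x : ℤ → Bool} (h : RecPt (shiftZ a x)) : RecPt x := by
  obtain ⟨U, hU, h⟩ := recPt_iff.1 h
  refine recPt_iff.2 ⟨U, hU, fun s => ?_⟩
  filter_upwards [h (s - a)] with t ht
  simp only [shiftZ] at ht
  rwa [sub_add_cancel, sub_add_eq_add_sub, sub_add_cancel] at ht

theorem recPt_of_shiftZ_eq {n : ℤ} (hn : n ≠ 0) {x : ℤ → Bool} (h : shiftZ n x = x) :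
    RecPt x := by
  have hinj : Function.Injective fun j : ℕ => (j : ℤ) * n := fun i j hij => by
    simpa [hn] using hij
  have hx : ∀ (j : ℕ) (s : ℤ), x (s + j * n) = x s := by
    intro j
    induction j with
    | zero => simp
    | succ j ih =>
      intro s
      have := congrFun h (s + j * n)
      rw [← ih s, ← this]
      simp only [shiftZ]
      congr 1
      push_cast
      ring
  refine recPt_iff.2 ⟨(Filter.hyperfilter ℕ).map fun j : ℕ => (j : ℤ) * n, ?_, fun s => ?_⟩
  · exact (Filter.map_mono (hyperfilter_le_cofinite)).trans hinj.tendsto_cofinite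
  · exact Filter.eventually_map.2 (Filter.Eventually.of_forall fun j : ℕ => hx j s)

theorem shiftZ_false (n : ℤ) : shiftZ n (fun _ => false) = fun _ => false := rfl

theorem recPt_false : RecPt fun _ : ℤ => false := recPt_of_shiftZ_eq one_ne_zero rfl

theorem orbitClosure_false : orbitClosure (fun _ : ℤ => false) = {fun _ => false} := by
  simp only [orbitClosure, shiftZ_false, Set.range_const, closure_singleton]

theorem orbitClosure_eq_of_isolated {x : ℤ → Bool} {O : Set (ℤ → Bool)} (hO : IsOpen O)
    (hn : ∀ n ≠ 0, shiftZ n x ∉ O) {z : ℤ → Bool} (hz : z ∈ orbitClosure x) (hzO : z ∈ O) :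
    z = x := by
  by_contra hne
  obtain ⟨w, ⟨hwO, hwx⟩, ⟨n, rfl⟩⟩ :=
    mem_closure_iff.1 hz (O ∩ {x}ᶜ) (hO.inter isOpen_compl_singleton) ⟨hzO, hne⟩
  refine hn n ?_ hwO
  rintro rfl
  exact hwx (shiftZ_zero x)

/-- A nonrecurrent point is isolated in its orbit. -/
theorem exists_isOpen_of_not_recPt {x : ℤ → Bool} (hx : ¬ RecPt x) :
    ∃ O, IsOpen O ∧ x ∈ O ∧ ∀ n ≠ 0, shiftZ n x ∉ O := by
  refine ⟨(closure ((fun n => shiftZ n x) '' {0}ᶜ))ᶜ, isClosed_closure.isOpen_compl, fun h => ?_,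
    fun n hn h => h (subset_closure ⟨n, hn, rfl⟩)⟩
  obtain ⟨U, hU, h⟩ := mem_closure_image_shiftZ_iff.1 h
  obtain hc | ⟨n, hn⟩ := U.le_cofinite_or_eq_pure
  · exact hx (recPt_iff.2 ⟨U, hc, h⟩)
  · subst hn
    refine hx (recPt_of_shiftZ_eq (n := n) hU (funext fun s => ?_))
    exact eventually_pure.1 (h s)

theorem exists_forall_eq_of_bdist_lt {O : Set (ℤ → Bool)} (hO : IsOpen O) {x : ℤ → Bool}
    (hx : x ∈ O) : ∃ δ > (0 : ℝ), ∀ z, bdist x z < δ → z ∈ O := by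
  obtain ⟨I, u, hu, hI⟩ := isOpen_pi_iff.1 hO x hx
  refine ⟨(2 : ℝ) ^ (-((I.sup Int.natAbs + 1 : ℕ) : ℤ)), by positivity, fun z hz => hI ?_⟩
  obtain ⟨r, ⟨N, hN, rfl⟩, hr⟩ := exists_lt_of_csInf_lt
    (⟨_, 0, fun t ht => absurd ht (abs_nonneg t).not_gt, rfl⟩ :
      {r : ℝ | ∃ N : ℕ, (∀ t : ℤ, |t| < (N : ℤ) → x t = z t) ∧ r = (2 : ℝ) ^ (-(N : ℤ))}.Nonempty) hz
  rw [zpow_lt_zpow_iff_right₀ one_lt_two] at hr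
  intro t ht
  have h1 : t.natAbs ≤ I.sup Int.natAbs := Finset.le_sup (f := Int.natAbs) ht
  rw [← hN t (by rw [Int.abs_eq_natAbs]; omega)]
  exact (hu t ht).2

theorem bdist_self_lt (x : ℤ → Bool) {ε : ℝ} (hε : 0 < ε) : bdist x x < ε := by
  obtain ⟨N, hN⟩ := exists_pow_lt_of_lt_one hε (by norm_num : (1 / 2 : ℝ) < 1)
  have hb : BddBelow {r : ℝ | ∃ N : ℕ, (∀ t : ℤ, |t| < (N : ℤ) → x t = x t) ∧
      r = (2 : ℝ) ^ (-(N : ℤ))} := by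
    refine ⟨0, ?_⟩
    rintro _ ⟨n, -, rfl⟩
    positivity
  exact (csInf_le hb ⟨N, fun _ _ => rfl, rfl⟩).trans_lt (by simpa using hN)

theorem topTransOn_orbitClosure (x : ℤ → Bool) : TopTransOn (orbitClosure x) :=
  ⟨x, self_mem_orbitClosure x, subset_rfl⟩

theorem leOn_of_recPt_eq_false {Z : Set (ℤ → Bool)}
    (h : ∀ x ∈ Z, RecPt x → x = fun _ => false) : LEOn Z := by
  intro x hx
  obtain ⟨O, hO, hxO, hu⟩ : ∃ O, IsOpen O ∧ x ∈ O ∧ ∀ z ∈ orbitClosure x, z ∈ O → z = x := by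
    by_cases hr : RecPt x
    · refine ⟨Set.univ, isOpen_univ, trivial, fun z hz _ => ?_⟩
      rw [h x hx hr] at hz ⊢
      rwa [orbitClosure_false] at hz
    · obtain ⟨O, hO, hxO, hn⟩ := exists_isOpen_of_not_recPt hr
      exact ⟨O, hO, hxO, fun z hz hzO => orbitClosure_eq_of_isolated hO hn hz hzO⟩
  intro ε hε
  obtain ⟨δ, hδ, hd⟩ := exists_forall_eq_of_bdist_lt hO hxO
  refine ⟨δ, hδ, fun y hy hxy n => ?_⟩
  rw [hu y hy (hd y hxy)]
  exact bdist_self_lt _ hε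

theorem not_weakMixOn_of_not_recPt {x : ℤ → Bool} (hx : ¬ RecPt x) :
    ¬ WeakMixOn (orbitClosure x) := by
  intro h
  obtain ⟨O, hO, hxO, hn⟩ := exists_isOpen_of_not_recPt hx
  have hne : (O ∩ orbitClosure x).Nonempty := ⟨x, hxO, self_mem_orbitClosure x⟩
  obtain ⟨n, ⟨_, ⟨z, ⟨hzO, hz⟩, rfl⟩, hwO, -⟩, ⟨_, ⟨z', ⟨hzO', hz'⟩, rfl⟩, hwO', -⟩⟩ :=
    h O O O (shiftZ (-1) ⁻¹' O) hO hO hO (hO.preimage (continuous_shiftZ _)) hne hne hne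
      ⟨shiftZ 1 x, by simpa [shiftZ_shiftZ, shiftZ_zero] using hxO, subset_closure ⟨1, rfl⟩⟩
  obtain rfl := orbitClosure_eq_of_isolated hO hn hz hzO
  obtain rfl := orbitClosure_eq_of_isolated hO hn hz' hzO'
  rw [Set.mem_preimage, shiftZ_shiftZ] at hwO'
  have h0 : n = 0 := by_contra fun hne => hn n hne hwO
  exact hn (-1 + n) (by omega) hwO'

theorem exists_strictMono_of_not_finiteType {M : Set (ℕ →₀ ℕ)} (h : ¬ FiniteType M) :
    ∃ f : ℕ → (ℕ →₀ ℕ), (∀ i, f i ∈ M) ∧ StrictMono f := not_not.1 h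

theorem FiniteType.mono {M N : Set (ℕ →₀ ℕ)} (hM : FiniteType M) (h : N ⊆ M) : FiniteType N :=
  fun ⟨f, hf, hf'⟩ => hM ⟨f, fun i => h (hf i), hf'⟩

theorem FiniteType.exists_maximal {M : Set (ℕ →₀ ℕ)} (hM : FiniteType M) (h : M.Nonempty) :
    ∃ m ∈ M, ∀ m' ∈ M, ¬ m < m' := by
  by_contra! H
  have : Nonempty M := h.to_subtype
  have : NoMaxOrder M := ⟨fun ⟨m, hm⟩ => by
    obtain ⟨m', hm', hlt⟩ := H m hm
    exact ⟨⟨m', hm'⟩, hlt⟩⟩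
  obtain ⟨f, hf⟩ := Nat.exists_strictMono M
  exact hM ⟨fun i => f i, fun i => (f i).2, fun i j hij => hf hij⟩

theorem digitVec_zero (L : ℕ → ℕ) : digitVec L 0 = 0 := Finsupp.sum_zero_index

theorem digitVec_pos (L : ℕ → ℕ) {c : ℕ →₀ ℤ} (hc : c ≠ 0) : 0 < digitVec L c := by
  obtain ⟨i, hi⟩ := Finsupp.ne_iff.1 hc
  refine lt_of_lt_of_le ?_ (Finset.single_le_sum (f := fun i => Finsupp.single (L i) (c i).natAbs)
    (fun _ _ => zero_le) (Finsupp.mem_support_iff.2 hi))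
  rw [pos_iff_ne_zero]
  simpa using hi

theorem sum_single_le_digitVec (L : ℕ → ℕ) {c : ℕ →₀ ℤ} {s : Finset ℕ} (hs : ∀ i ∈ s, c i ≠ 0) :
    ∑ i ∈ s, Finsupp.single (L i) 1 ≤ digitVec L c := by
  refine le_trans (Finset.sum_le_sum fun i hi => ?_)
    (Finset.sum_le_sum_of_subset (f := fun i => Finsupp.single (L i) (c i).natAbs)
      fun i hi => Finsupp.mem_support_iff.2 (hs i hi))
  exact Finsupp.single_mono (Int.natAbs_pos.2 (hs i hi))

/-- Digits of the elements of a set of finite type converge along an ultrafilter, and the limit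
has finite support. -/
theorem exists_digit_limit {L : ℕ → ℕ} {M : Set (ℕ →₀ ℕ)} (hM : IsLabel M) (hft : FiniteType M)
    {U : Ultrafilter ℤ} {dig : ℤ → ℕ →₀ ℤ} (hdig : ∀ᶠ t in U, ∀ i, |dig t i| ≤ 1)
    (hvec : ∀ᶠ t in U, digitVec L (dig t) ∈ M) :
    ∃ e : ℕ →₀ ℤ, ∀ i, ∀ᶠ t in U, dig t i = e i := by
  have h1 : ∀ i, ∃ a : ℤ, ∀ᶠ t in U, dig t i = a := by
    intro i
    have : ∀ᶠ t in U, dig t i = -1 ∨ dig t i = 0 ∨ dig t i = 1 := by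
      filter_upwards [hdig] with t ht
      have := abs_le.1 (ht i)
      omega
    simp only [Ultrafilter.eventually_or] at this
    obtain h | h | h := this
    exacts [⟨_, h⟩, ⟨_, h⟩, ⟨_, h⟩]
  choose e he using h1
  have hfin : {i | e i ≠ 0}.Finite := by
    by_contra hinf
    have hφ := Nat.nth_strictMono (p := fun i => e i ≠ 0) hinf
    have hφ' : ∀ j, e (Nat.nth (fun i => e i ≠ 0) j) ≠ 0 := fun j => Nat.nth_mem_of_infinite hinf j
    set φ := Nat.nth fun i => e i ≠ 0
    refine hft ⟨fun n => ∑ i ∈ (Finset.range n).image φ, Finsupp.single (L i) 1, fun n => ?_,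
      strictMono_nat_of_lt_succ fun n => ?_⟩
    · have : ∀ᶠ t in U, ∀ j ∈ Finset.range n, dig t (φ j) = e (φ j) :=
        (Filter.eventually_all_finset _).2 fun j _ => he (φ j)
      obtain ⟨t, ht, hv⟩ := (this.and hvec).exists
      refine hM _ _ (sum_single_le_digitVec L fun i hi => ?_) hv
      obtain ⟨j, hj, rfl⟩ := Finset.mem_image.1 hi
      rw [ht j hj]
      exact hφ' j
    · simp only [Finset.sum_image hφ.injective.injOn, Finset.sum_range_succ]
      refine lt_add_of_pos_right _ ?_
      rw [pos_iff_ne_zero]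
      simp
  refine ⟨Finsupp.onFinset hfin.toFinset e fun i hi => by simpa using hi, fun i => ?_⟩
  simpa using he i

theorem digits_add_mem {C : Set ℤ} {c d : ℕ →₀ ℤ} (hc : ∀ i, c i ∈ C) (hd : ∀ i, d i ∈ C)
    {n : ℕ} (hcn : ∀ i, n ≤ i → c i = 0) (hdn : ∀ i < n, d i = 0) :
    ∀ i, (c + d) i ∈ C := by
  intro i
  rw [Finsupp.add_apply]
  rcases lt_or_ge i n with h | h
  · rw [hdn i h, add_zero]; exact hc i
  · rw [hcn i h, zero_add]; exact hd i

theorem disjoint_support_of_lt {c d : ℕ →₀ ℤ} {n : ℕ} (hcn : ∀ i, n ≤ i → c i = 0)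
    (hdn : ∀ i < n, d i = 0) : Disjoint c.support d.support := by
  rw [Finset.disjoint_left]
  intro i hi hi'
  rcases lt_or_ge i n with h | h
  · exact Finsupp.mem_support_iff.1 hi' (hdn i h)
  · exact Finsupp.mem_support_iff.1 hi (hcn i h)

theorem exists_forall_le_eq_zero (c : ℕ →₀ ℤ) : ∃ n, ∀ i, n ≤ i → c i = 0 := by
  refine ⟨c.support.sup id + 1, fun i hi => ?_⟩
  by_contra h
  have : i ≤ c.support.sup id := Finset.le_sup (f := id) (Finsupp.mem_support_iff.2 h)
  omega

/-- Along an ultrafilter containing `digitSums K L C M`, the elements split as `u + digitVal K (q t)`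
with `u` fixed and the digits `q t` escaping to infinity; the translates of the set converge to a
translate of the set given by a smaller label. -/
theorem exists_limit_digitSums {K : ℕ → ℤ} (hK : ∀ n, 3 * ∑ i ∈ Finset.range n, K i < K n)
    {L : ℕ → ℕ} {C : Set ℤ} (hC0 : 0 ∈ C) (hC : ∀ a ∈ C, |a| ≤ 1)
    {M : Set (ℕ →₀ ℕ)} (hM : IsLabel M) (hft : FiniteType M)
    {U : Ultrafilter ℤ} (hU : ∀ᶠ t in U, t ∈ digitSums K L C M) :
    ∃ (u : ℤ) (q : ℤ → ℕ →₀ ℤ),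
      (∀ᶠ t in U, t = u + digitVal K (q t)) ∧ (∀ᶠ t in U, ∀ i, q t i ∈ C) ∧
      (∀ n, ∀ᶠ t in U, ∀ i < n, q t i = 0) ∧
      ∀ s, (∀ᶠ t in U, s + t ∈ digitSums K L C M) ↔
        s + u ∈ digitSums K L C {m | ∀ᶠ t in U, m + digitVec L (q t) ∈ M} := by
  have hex : ∀ t, ∃ c : ℕ →₀ ℤ, t ∈ digitSums K L C M →
      (∀ i, c i ∈ C) ∧ digitVec L c ∈ M ∧ digitVal K c = t := by
    intro t
    by_cases ht : t ∈ digitSums K L C M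
    · obtain ⟨c, hc⟩ := ht
      exact ⟨c, fun _ => hc⟩
    · exact ⟨0, fun h => absurd h ht⟩
  choose dig hdig using hex
  obtain ⟨e, he⟩ := exists_digit_limit (L := L) hM hft (U := U) (dig := dig)
    (hU.mono fun t ht i => hC _ ((hdig t ht).1 i)) (hU.mono fun t ht => (hdig t ht).2.1)
  obtain ⟨n₀, hn₀⟩ := exists_forall_le_eq_zero e
  have hq0 : ∀ n, ∀ᶠ t in U, ∀ i < n, (dig t - e) i = 0 := by
    intro n
    have : ∀ᶠ t in U, ∀ i ∈ Finset.range n, dig t i = e i :=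
      (Filter.eventually_all_finset _).2 fun j _ => he j
    filter_upwards [this] with t ht i hi
    rw [Finsupp.sub_apply, ht i (Finset.mem_range.2 hi), sub_self]
  have hqC : ∀ᶠ t in U, ∀ i, (dig t - e) i ∈ C := by
    filter_upwards [hq0 n₀, hU] with t ht htA i
    rcases lt_or_ge i n₀ with h | h
    · rw [ht i h]; exact hC0
    · rw [Finsupp.sub_apply, hn₀ i h, sub_zero]; exact (hdig t htA).1 i
  have hqv : ∀ᶠ t in U, t = digitVal K e + digitVal K (dig t - e) := by
    filter_upwards [hU] with t ht
    rw [← map_add, add_sub_cancel, (hdig t ht).2.2]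
  refine ⟨digitVal K e, fun t => dig t - e, hqv, hqC, hq0, fun s => ⟨fun hs => ?_, ?_⟩⟩
  · obtain ⟨n, hn, hsn⟩ := exists_le_sum_of_growth hK |s| n₀
    have key : ∀ᶠ t in U, ∃ c : ℕ →₀ ℤ, (∀ i, c i ∈ C) ∧ digitVal K c = s + digitVal K e ∧
        digitVec L c + digitVec L (dig t - e) ∈ M := by
      filter_upwards [hs, hU, hq0 n, hqv] with t hst ht hqt hv
      have hdd : ∀ i, n ≤ i → dig (s + t) i = dig t i := by
        refine digit_eq_of_abs_sub_le hK (fun i => hC _ ((hdig _ hst).1 i))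
          (fun i => hC _ ((hdig _ ht).1 i)) ?_
        rw [(hdig _ hst).2.2, (hdig _ ht).2.2, add_sub_cancel_right]
        exact hsn
      have hlow : ∀ i < n, (dig (s + t) - (dig t - e)) i = dig (s + t) i := fun i hi => by
        rw [Finsupp.sub_apply, hqt i hi, sub_zero]
      have hhigh : ∀ i, n ≤ i → (dig (s + t) - (dig t - e)) i = 0 := fun i hi => by
        rw [Finsupp.sub_apply, Finsupp.sub_apply, hdd i hi, hn₀ i (hn.trans hi)]; ring
      refine ⟨dig (s + t) - (dig t - e), fun i => ?_, ?_, ?_⟩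
      · rcases lt_or_ge i n with h | h
        · rw [hlow i h]; exact (hdig _ hst).1 i
        · rw [hhigh i h]; exact hC0
      · rw [map_sub, (hdig _ hst).2.2]; linarith
      · rw [← digitVec_add L (disjoint_support_of_lt hhigh hqt), sub_add_cancel]
        exact (hdig _ hst).2.1
    obtain ⟨-, c, hc, hcv, -⟩ := key.exists
    refine ⟨c, hc, ?_, hcv⟩
    filter_upwards [key] with t ⟨c', hc', hcv', hm⟩
    rwa [digitVal_injective_of_growth hK (fun i => hC _ (hc i)) (fun i => hC _ (hc' i))
      (hcv.trans hcv'.symm)]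
  · rintro ⟨c, hc, hm, hcv⟩
    obtain ⟨n, hn⟩ := exists_forall_le_eq_zero c
    filter_upwards [hm, hq0 n, hqC, hqv] with t hmt hqt hqCt hv
    refine ⟨c + (dig t - e), digits_add_mem hc hqCt hn hqt, ?_, ?_⟩
    · rwa [digitVec_add L (disjoint_support_of_lt hn hqt)]
    · rw [map_add, hcv]; linarith

theorem isLabel_eventually {M : Set (ℕ →₀ ℕ)} (hM : IsLabel M) (U : Filter ℤ) (f : ℤ → ℕ →₀ ℕ) :
    IsLabel {m | ∀ᶠ t in U, m + f t ∈ M} :=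
  fun _ _ h hm => hm.mono fun t ht => hM _ _ (add_le_add_left h (f t)) ht

theorem eventually_add_mem_subset {M : Set (ℕ →₀ ℕ)} (hM : IsLabel M) (U : Ultrafilter ℤ)
    (f : ℤ → ℕ →₀ ℕ) : {m | ∀ᶠ t in U, m + f t ∈ M} ⊆ M := fun m hm => by
  obtain ⟨t, ht⟩ := Filter.Eventually.exists (f := (U : Filter ℤ)) hm
  exact hM _ _ le_self_add ht

theorem digitSums_mono {K : ℕ → ℤ} {L : ℕ → ℕ} {C : Set ℤ} {M N : Set (ℕ →₀ ℕ)} (h : N ⊆ M) :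
    digitSums K L C N ⊆ digitSums K L C M :=
  fun _ ⟨c, hc, hm, hv⟩ => ⟨c, hc, h hm, hv⟩

theorem zero_mem_digitSums {K : ℕ → ℤ} {L : ℕ → ℕ} {C : Set ℤ} (hC0 : 0 ∈ C)
    {M : Set (ℕ →₀ ℕ)} (hM : (0 : ℕ →₀ ℕ) ∈ M) : 0 ∈ digitSums K L C M :=
  ⟨0, fun _ => hC0, by rwa [digitVec_zero], map_zero _⟩

theorem chiB_eq_true {A : Set ℤ} {t : ℤ} : chiB A t = true ↔ t ∈ A := by
  simp [chiB]

theorem chiB_eq_chiB_iff {A B : Set ℤ} {s t : ℤ} : chiB A s = chiB B t ↔ (s ∈ A ↔ t ∈ B) := by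
  rw [Bool.eq_iff_iff, chiB_eq_true, chiB_eq_true]

theorem not_recPt_chiB_digitSums {K : ℕ → ℤ} (hK : ∀ n, 3 * ∑ i ∈ Finset.range n, K i < K n)
    {L : ℕ → ℕ} {C : Set ℤ} (hC0 : 0 ∈ C) (hC : ∀ a ∈ C, |a| ≤ 1)
    {M : Set (ℕ →₀ ℕ)} (hM : IsLabel M) (hft : FiniteType M) (hne : M.Nonempty) :
    ¬ RecPt (chiB (digitSums K L C M)) := by
  intro hrec
  obtain ⟨U, hU, hrec⟩ := recPt_iff.1 hrec
  simp only [chiB_eq_chiB_iff] at hrec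
  have h0M : (0 : ℕ →₀ ℕ) ∈ M := hM _ _ (zero_le) hne.some_mem
  have h0 := zero_mem_digitSums (K := K) (L := L) hC0 h0M
  have hA : ∀ s ∈ digitSums K L C M, ∀ᶠ t in U, s + t ∈ digitSums K L C M := fun s hs =>
    (hrec s).mono fun t ht => ht.2 hs
  obtain ⟨u, q, hqv, hqC, hq0, hlim⟩ := exists_limit_digitSums hK hC0 hC hM hft (U := U)
    (by simpa using hA 0 h0)
  have hsub := eventually_add_mem_subset hM U fun t => digitVec L (q t)
  have hu : u = 0 := by
    by_contra hu
    obtain ⟨N, hN⟩ := exists_progression_not_mem hK hu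
    obtain ⟨j, -, hj⟩ := hN 0
    have : ∀ j : ℕ, (j : ℤ) * u + 0 ∈ digitSums K L C M := by
      intro j
      induction j with
      | zero => simpa using h0
      | succ j ih =>
        have := digitSums_mono hsub ((hlim _).1 (hA _ ih))
        convert this using 1
        push_cast
        ring
    obtain ⟨c, hc, -, hcv⟩ := this j
    exact hj c (fun i => hC _ (hc i)) hcv
  obtain ⟨_, ⟨⟨c, hc, rfl⟩, hcM⟩, hmax⟩ := FiniteType.exists_maximal
    (M := {m | ∃ c : ℕ →₀ ℤ, (∀ i, c i ∈ C) ∧ digitVec L c = m} ∩ M)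
    (hft.mono Set.inter_subset_right) ⟨0, ⟨0, fun _ => hC0, digitVec_zero L⟩, h0M⟩
  obtain ⟨c', hc', hm', hv'⟩ := (hlim _).1 (hA _ ⟨c, hc, hcM, rfl⟩)
  rw [hu, add_zero] at hv'
  obtain rfl := digitVal_injective_of_growth hK (fun i => hC _ (hc' i)) (fun i => hC _ (hc i)) hv'
  obtain ⟨n, hn⟩ := exists_forall_le_eq_zero c'
  have hne0 : ∀ᶠ t : ℤ in U, t ≠ 0 :=
    (eventually_cofinite_ne 0).filter_mono hU
  obtain ⟨t, ht, htv, htC, ht0, htm⟩ :=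
    (hne0.and (hqv.and (hqC.and ((hq0 n).and hm')))).exists
  have hvec := digitVec_add L (disjoint_support_of_lt hn ht0)
  refine hmax (digitVec L (c' + q t)) ⟨⟨_, digits_add_mem hc' htC hn ht0, rfl⟩, ?_⟩ ?_
  · rwa [hvec]
  · rw [hvec]
    refine lt_add_of_pos_right _ (digitVec_pos L fun h => ht ?_)
    rw [htv, h, map_zero, hu, add_zero]

theorem eq_false_of_recPt {K : ℕ → ℤ} (hK : ∀ n, 3 * ∑ i ∈ Finset.range n, K i < K n)
    {L : ℕ → ℕ} {C : Set ℤ} (hC0 : 0 ∈ C) (hC : ∀ a ∈ C, |a| ≤ 1)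
    {M : Set (ℕ →₀ ℕ)} (hM : IsLabel M) (hft : FiniteType M) {y : ℤ → Bool}
    (hy : y ∈ orbitClosure (chiB (digitSums K L C M))) (hrec : RecPt y) :
    y = fun _ => false := by
  by_contra hne
  obtain ⟨s₀, hs₀⟩ := Function.ne_iff.1 hne
  rw [ne_eq, Bool.not_eq_false] at hs₀
  obtain ⟨U, hU⟩ := mem_orbitClosure_iff.1 hy
  have hmem : ∀ s, y s = true ↔ ∀ᶠ t in U, s + t ∈ digitSums K L C M := by
    intro s
    have : ∀ᶠ t in U, (s + t ∈ digitSums K L C M ↔ y s = true) := by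
      filter_upwards [hU s] with t ht
      rw [← ht, chiB_eq_true]
    exact ⟨fun h => this.mono fun t ht => ht.2 h, fun h => by
      obtain ⟨t, ht, ht'⟩ := (this.and h).exists
      exact ht.1 ht'⟩
  obtain ⟨u, q, -, -, -, hlim⟩ := exists_limit_digitSums hK hC0 hC hM hft
    (U := U.map (s₀ + ·)) (by simpa using (hmem s₀).1 hs₀)
  have hsub := eventually_add_mem_subset hM (U.map (s₀ + ·)) fun t => digitVec L (q t)
  have hlab := isLabel_eventually hM (U.map (s₀ + ·)) fun t => digitVec L (q t)
  set N := {m | ∀ᶠ t in (U.map (s₀ + ·) : Ultrafilter ℤ), m + digitVec L (q t) ∈ M}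
  have hyN : y = shiftZ (u - s₀) (chiB (digitSums K L C N)) := by
    funext s
    rw [Bool.eq_iff_iff, shiftZ, chiB_eq_true, hmem,
      show s + (u - s₀) = (s - s₀) + u by ring, ← hlim, Ultrafilter.coe_map, Filter.eventually_map]
    simp only [← add_assoc, sub_add_cancel]
  have hNne : N.Nonempty := by
    rw [hyN, shiftZ, chiB_eq_true] at hs₀
    obtain ⟨c, -, hc, -⟩ := hs₀
    exact ⟨_, hc⟩
  rw [hyN] at hrec
  exact not_recPt_chiB_digitSums hK hC0 hC hlab (hft.mono hsub) hNne hrec.of_shiftZ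

theorem false_mem_orbitClosure {K : ℕ → ℤ} (hK : ∀ n, 3 * ∑ i ∈ Finset.range n, K i < K n)
    {L : ℕ → ℕ} {C : Set ℤ} (hC : ∀ a ∈ C, |a| ≤ 1) (M : Set (ℕ →₀ ℕ)) :
    (fun _ => false) ∈ orbitClosure (chiB (digitSums K L C M)) := by
  choose g hg using fun N : ℕ => exists_gap hK N
  refine mem_closure_of_tendsto (f := fun N => shiftZ (g N) (chiB (digitSums K L C M)))
    (b := (atTop : Filter ℕ)) ?_ (Filter.Eventually.of_forall fun N => ⟨g N, rfl⟩)
  simp only [tendsto_pi_nhds, nhds_discrete, tendsto_pure, shiftZ]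
  intro s
  filter_upwards [eventually_ge_atTop s.natAbs] with N hN
  rw [← Bool.not_eq_true, chiB_eq_true]
  rintro ⟨c, hc, -, hv⟩
  exact hg N s (by rw [Int.abs_eq_natAbs]; omega) c (fun i => hC _ (hc i)) hv

theorem exists_idempotent_ultrafilter_FS (a : Stream' ℤ) :
    ∃ U : Ultrafilter ℤ,
      (∀ p : ℤ → Prop, (∀ᶠ m in U, p m) ↔ ∀ᶠ m in U, ∀ᶠ m' in U, p (m + m')) ∧
      ∀ᶠ m in U, m ∈ Hindman.FS a := by
  obtain ⟨U, hU, ha⟩ := Hindman.exists_idempotent_ultrafilter_le_FS a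
  refine ⟨U, fun p => ?_, ha⟩
  conv_lhs => rw [← hU]
  exact Ultrafilter.eventually_add U U p

theorem exists_finset_of_mem_FS {a : Stream' ℤ} {t : ℤ} (ht : t ∈ Hindman.FS a) (g : ℕ → ℤ)
    (n : ℕ) (ha : ∀ i, a.get i = g (n + i)) :
    ∃ F : Finset ℕ, F.Nonempty ∧ (∀ i ∈ F, n ≤ i) ∧ t = ∑ i ∈ F, g i := by
  induction ht generalizing n with
  | head' a => exact ⟨{n}, by simp, by simp, by simpa using ha 0⟩
  | tail' a m _ ih =>
    obtain ⟨F, hF, hn, hs⟩ := ih (n + 1) fun i => by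
      rw [Stream'.get_tail, ha]
      congr 1
      ring
    exact ⟨F, hF, fun i hi => (Nat.le_succ n).trans (hn i hi), hs⟩
  | cons' a m _ ih =>
    obtain ⟨F, hF, hn, hs⟩ := ih (n + 1) fun i => by
      rw [Stream'.get_tail, ha]
      congr 1
      ring
    refine ⟨insert n F, Finset.insert_nonempty _ _, fun i hi => ?_, ?_⟩
    · rcases Finset.mem_insert.1 hi with rfl | hi
      exacts [le_rfl, (Nat.le_succ n).trans (hn i hi)]
    · rw [Finset.sum_insert fun h => by have := hn n h; omega, ← hs]
      congr 1
      simpa using ha 0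

/-- A label not of finite type yields an infinite sequence of base elements all of whose finite
sums lie in the corresponding set. -/
theorem exists_sums_mem_of_not_finiteType (K : ℕ → ℤ) {L : ℕ → ℕ}
    (hL : ∀ ℓ, ∃ᶠ n in atTop, L n = ℓ) {C : Set ℤ} (hC0 : 0 ∈ C) (hC1 : 1 ∈ C)
    {M : Set (ℕ →₀ ℕ)} (hM : IsLabel M) (hft : ¬ FiniteType M) :
    ∃ φ : ℕ → ℕ, ∀ F : Finset ℕ, ∑ i ∈ F, K (φ i) ∈ digitSums K L C M := by
  obtain ⟨f, hfM, hf⟩ := exists_strictMono_of_not_finiteType hft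
  have hlt : ∀ i, ∃ ℓ, f i ℓ < f (i + 1) ℓ := by
    intro i
    by_contra! h
    exact (hf (Nat.lt_succ_self i)).not_ge h
  choose ℓ hℓ using hlt
  obtain ⟨φ, hφ, hφL⟩ := Filter.extraction_forall_of_frequently fun n => hL (ℓ n)
  refine ⟨φ, fun F => ?_⟩
  have hbound : ∀ n, ∑ i ∈ Finset.range n, Finsupp.single (ℓ i) 1 ≤ f n := by
    intro n
    induction n with
    | zero => simp
    | succ n ih =>
      rw [Finset.sum_range_succ]
      refine (add_le_add_left ih _).trans fun j => ?_
      rw [Finsupp.add_apply, Finsupp.single_apply]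
      split_ifs with h
      · subst h; exact hℓ n
      · exact (hf (Nat.lt_succ_self n)).le j
  have hinj : Set.InjOn φ F := hφ.injective.injOn
  refine ⟨Finsupp.indicator (F.image φ) fun _ _ => 1, fun i => ?_, ?_, ?_⟩
  · rw [Finsupp.indicator_apply]
    split_ifs
    exacts [hC1, hC0]
  · refine hM _ _ ?_ (hfM (F.sup id + 1))
    rw [digitVec, Finsupp.sum_indicator_index _ (by simp), Finset.sum_image hinj]
    simp only [hφL, Int.natAbs_one]
    refine le_trans (Finset.sum_le_sum_of_subset fun i hi => ?_) (hbound _)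
    have : i ≤ F.sup id := Finset.le_sup (f := id) hi
    exact Finset.mem_range.2 (by omega)
  · rw [digitVal, Finsupp.linearCombination_apply, Finsupp.sum_indicator_index _ (by simp),
      Finset.sum_image hinj]
    simp

theorem exists_recPt_not_perPt {K : ℕ → ℤ} (hK : ∀ n, 3 * ∑ i ∈ Finset.range n, K i < K n)
    {L : ℕ → ℕ} (hL : ∀ ℓ, ∃ᶠ n in atTop, L n = ℓ)
    {C : Set ℤ} (hC0 : 0 ∈ C) (hC1 : 1 ∈ C) (hC : ∀ a ∈ C, |a| ≤ 1)
    {M : Set (ℕ →₀ ℕ)} (hM : IsLabel M) (hft : ¬ FiniteType M) :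
    ∃ y ∈ orbitClosure (chiB (digitSums K L C M)), RecPt y ∧ ¬ PerPt y := by
  obtain ⟨φ, hφ⟩ := exists_sums_mem_of_not_finiteType K hL hC0 hC1 hM hft
  obtain ⟨U, hidem, hFS⟩ := exists_idempotent_ultrafilter_FS fun i => K (φ i)
  have hF : ∀ᶠ t in U, t ∈ digitSums K L C M ∧ 0 < t := by
    filter_upwards [hFS] with t ht
    obtain ⟨F, hne, -, rfl⟩ := exists_finset_of_mem_FS ht (fun i => K (φ i)) 0
      fun i => by rw [zero_add]; rfl
    exact ⟨hφ F, Finset.sum_pos (fun i _ => pos_of_growth hK _) hne⟩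
  set A := digitSums K L C M
  have hU : (U : Filter ℤ) ≤ cofinite := by
    obtain h | ⟨n, hn⟩ := U.le_cofinite_or_eq_pure
    · exact h
    · subst hn
      have h1 := (hidem fun m => m = n).1 rfl
      have h2 : n + n = n := h1
      have h3 : n ∈ A ∧ 0 < n := hF
      omega
  set B : Set ℤ := {s | ∀ᶠ t in U, s + t ∈ A}
  have hB : ∀ s, ∀ᶠ t in U, (s + t ∈ A ↔ s ∈ B) := by
    intro s
    by_cases h : s ∈ B
    · exact Filter.Eventually.mono h fun t ht => iff_of_true ht h
    · exact (Ultrafilter.eventually_not.2 h).mono fun t ht => iff_of_false ht h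
  have hBB : ∀ s, s ∈ B ↔ ∀ᶠ t in U, s + t ∈ B := by
    intro s
    refine (hidem fun m => s + m ∈ A).trans ?_
    simp only [B, Set.mem_ofPred_eq, add_assoc]
  have h0 : (0 : ℤ) ∈ B := hF.mono fun t ht => by rw [zero_add]; exact ht.1
  refine ⟨chiB B, ?_, ?_, ?_⟩
  · exact mem_orbitClosure_iff.2 ⟨U, fun s => (hB s).mono fun t ht => chiB_eq_chiB_iff.2 ht⟩
  · refine recPt_iff.2 ⟨U, hU, fun s => ?_⟩
    simp only [chiB_eq_chiB_iff]
    by_cases h : s ∈ B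
    · exact ((hBB s).1 h).mono fun t ht => iff_of_true ht h
    · exact (Ultrafilter.eventually_not.2 fun h' => h ((hBB s).2 h')).mono
        fun t ht => iff_of_false ht h
  · rintro ⟨n, hn, hper⟩
    have hmem : ∀ j : ℕ, (j : ℤ) * n ∈ B := by
      intro j
      induction j with
      | zero => simpa using h0
      | succ j ih =>
        have := congrFun hper (j * n)
        rw [shiftZ, chiB_eq_chiB_iff] at this
        convert this.2 ih using 1
        push_cast
        ring
    obtain ⟨N, hN⟩ := exists_progression_not_mem hK (p := n) (by omega)
    have hall : ∀ᶠ t in U, ∀ j ∈ Finset.range (N + 1), (j : ℤ) * n + t ∈ A :=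
      (Filter.eventually_all_finset _).2 fun j _ => hmem j
    obtain ⟨t, ht⟩ := hall.exists
    obtain ⟨j, hj, hj'⟩ := hN t
    obtain ⟨c, hc, -, hcv⟩ := ht j (Finset.mem_range.2 (by omega))
    exact hj' c (fun i => hC _ (hc i)) hcv

theorem recPt_iff_of_finiteType {K : ℕ → ℤ} (hK : ∀ n, 3 * ∑ i ∈ Finset.range n, K i < K n)
    {L : ℕ → ℕ} {C : Set ℤ} (hC0 : 0 ∈ C) (hC : ∀ a ∈ C, |a| ≤ 1)
    {M : Set (ℕ →₀ ℕ)} (hM : IsLabel M) (hft : FiniteType M) {y : ℤ → Bool}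
    (hy : y ∈ orbitClosure (chiB (digitSums K L C M))) : RecPt y ↔ y = fun _ => false :=
  ⟨eq_false_of_recPt hK hC0 hC hM hft hy, fun h => h ▸ recPt_false⟩

theorem leOn_of_finiteType {K : ℕ → ℤ} (hK : ∀ n, 3 * ∑ i ∈ Finset.range n, K i < K n)
    {L : ℕ → ℕ} {C : Set ℤ} (hC0 : 0 ∈ C) (hC : ∀ a ∈ C, |a| ≤ 1)
    {M : Set (ℕ →₀ ℕ)} (hM : IsLabel M) (hft : FiniteType M) :
    LEOn (orbitClosure (chiB (digitSums K L C M))) :=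
  leOn_of_recPt_eq_false fun _ hy => eq_false_of_recPt hK hC0 hC hM hft hy

section Bridge

variable {b : ℕ} {k : ℤ → ℤ}

theorem IsExpanding.map_zero (hk : IsExpanding b k) : k 0 = 0 := by
  have := hk.1 0
  rw [neg_zero] at this
  omega

theorem IsExpanding.growth (hb : 3 ≤ b) (hk : IsExpanding b k) (n : ℕ) :
    3 * ∑ i ∈ Finset.range n, k (i + 1) < k (n + 1) := by
  induction n using Nat.strong_induction_on with
  | _ n ih =>
    have h := hk.2 n
    rw [Finset.sum_range_succ', Nat.cast_zero, hk.map_zero, add_zero] at h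
    push_cast at h
    have hnn : 0 ≤ ∑ i ∈ Finset.range n, k (i + 1) := by
      clear h
      induction n with
      | zero => simp
      | succ n ihn =>
        have := ihn fun m hm => ih m (by omega)
        rw [Finset.sum_range_succ]
        linarith [ih n (by omega)]
    have hb' : (3 : ℤ) ≤ b := by exact_mod_cast hb
    nlinarith

theorem IsExpanding.strictMono (hb : 3 ≤ b) (hk : IsExpanding b k) :
    StrictMono fun n : ℕ => k (n + 1) := by
  refine strictMono_nat_of_lt_succ fun n => ?_
  have h1 := hk.growth hb n
  have h2 := hk.growth hb (n + 1)
  have h3 := sum_nonneg_of_growth (K := fun n : ℕ => k (n + 1)) (hk.growth hb) n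
  rw [Finset.sum_range_succ] at h2
  push_cast at h2 ⊢
  linarith

/-- The digit of the signed index `j` sits at place `|j| - 1`. -/
theorem lengthVec_digitVal {lab : ℕ → ℕ} {R : ℤ → ℕ →₀ ℕ} (hk : IsExpanding b k)
    (hR : LengthVecSpec k lab R) {c : ℕ →₀ ℤ} (hc : ∀ i, |c i| ≤ 1) :
    R (digitVal (fun n : ℕ => k (n + 1)) c) = digitVec (fun n => lab (n + 1)) c := by
  set g := c.support.orderEmbOfFin rfl with hg
  have hgc : ∀ i, c (g i) = 1 ∨ c (g i) = -1 := fun i => by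
    have h1 := Finsupp.mem_support_iff.1 (Finset.orderEmbOfFin_mem c.support rfl i)
    have h2 := abs_le.1 (hc (g i))
    rw [← hg] at h1
    omega
  have habs : ∀ i, |c (g i) * ((g i : ℤ) + 1)| = (g i : ℤ) + 1 := fun i => by
    rw [abs_mul, abs_of_nonneg (by positivity : (0 : ℤ) ≤ (g i : ℤ) + 1)]
    rcases hgc i with h | h <;> simp [h]
  have hsum : ∀ {α : Type} [AddCommMonoid α] (f : ℕ → α),
      ∑ i : Fin c.support.card, f (g (Fin.rev i)) = ∑ n ∈ c.support, f n := fun f => by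
    refine (Equiv.sum_comp Fin.revPerm fun i => f (g i)).trans ?_
    conv_rhs => rw [← Finset.map_orderEmbOfFin_univ c.support rfl, Finset.sum_map]
    rfl
  have hexp : IsExpansion k (digitVal (fun n : ℕ => k (n + 1)) c) c.support.card
      fun i => c (g (Fin.rev i)) * ((g (Fin.rev i) : ℤ) + 1) := by
    refine ⟨fun i => ?_, fun i j hij => ?_, ?_⟩
    · rw [← abs_pos, habs]
      positivity
    · rw [habs, habs]
      have : g (Fin.rev j) < g (Fin.rev i) := g.strictMono (Fin.rev_lt_rev.2 hij)
      omega
    · rw [hsum fun n => k (c n * ((n : ℤ) + 1)), digitVal, Finsupp.linearCombination_apply]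
      refine Finset.sum_congr rfl fun n hn => ?_
      have h1 := Finsupp.mem_support_iff.1 hn
      have h2 := abs_le.1 (hc n)
      obtain h | h : c n = 1 ∨ c n = -1 := by omega
      · simp [h]
      · simp only [h, neg_one_mul, hk.1, smul_eq_mul]
  rw [hR _ _ _ hexp, digitVec, Finsupp.sum, ← hsum]
  refine Finset.sum_congr rfl fun i _ => ?_
  have h1 : (c (g (Fin.rev i)) * ((g (Fin.rev i) : ℤ) + 1)).natAbs = g (Fin.rev i) + 1 := by
    have := habs (Fin.rev i)
    rw [Int.abs_eq_natAbs] at this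
    omega
  have h2 : (c (g (Fin.rev i))).natAbs = 1 := by
    rcases hgc (Fin.rev i) with h | h <;> simp [h]
  rw [h1, h2]

theorem exists_digits_of_sum (hb : 3 ≤ b) (hk : IsExpanding b k) (F : Finset ℤ)
    (hF : ↑F ⊆ Set.range k) :
    ∃ c : ℕ →₀ ℤ, (∀ i : ℕ, c i =
        (if k (i + 1) ∈ F then 1 else 0) - (if -k (i + 1) ∈ F then 1 else 0)) ∧
      digitVal (fun n : ℕ => k (n + 1)) c = ∑ x ∈ F, x := by
  have hpos : ∀ n : ℕ, 0 < k (n + 1) := pos_of_growth (hk.growth hb)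
  have hinj : ∀ m n : ℕ, k (m + 1) = k (n + 1) ↔ m = n := fun m n => (hk.strictMono hb).injective.eq_iff
  induction F using Finset.induction_on with
  | empty => exact ⟨0, by simp, by simp⟩
  | insert x F hx ih =>
    rw [Finset.coe_insert, Set.insert_subset_iff] at hF
    obtain ⟨⟨j, rfl⟩, hF⟩ := hF
    obtain ⟨c, hc, hv⟩ := ih hF
    rw [Finset.sum_insert hx, ← hv]
    rcases lt_trichotomy j 0 with hj | rfl | hj
    · obtain ⟨n, rfl⟩ : ∃ n : ℕ, j = -((n : ℤ) + 1) := ⟨(-j - 1).toNat, by omega⟩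
      rw [hk.1] at hx ⊢
      refine ⟨Finsupp.single n (-1) + c, fun i => ?_, by simp [digitVal]⟩
      have h1 : k (i + 1) ≠ -k (n + 1) := by linarith [hpos i, hpos n]
      rw [Finsupp.add_apply, hc, Finsupp.single_apply]
      simp only [Finset.mem_insert, h1, false_or, neg_inj, hinj]
      by_cases hin : n = i
      · subst hin; simp [hx]; ring
      · simp [hin, Ne.symm hin]
    · refine ⟨c, fun i => ?_, by rw [hk.map_zero, zero_add]⟩
      rw [hc, hk.map_zero]
      simp [(hpos i).ne']
    · obtain ⟨n, rfl⟩ : ∃ n : ℕ, j = (n : ℤ) + 1 := ⟨(j - 1).toNat, by omega⟩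
      refine ⟨Finsupp.single n 1 + c, fun i => ?_, by simp [digitVal]⟩
      have h1 : -k (i + 1) ≠ k (n + 1) := by linarith [hpos i, hpos n]
      rw [Finsupp.add_apply, hc, Finsupp.single_apply]
      simp only [Finset.mem_insert, h1, false_or, hinj]
      by_cases hin : n = i
      · subst hin; simp [hx]; ring
      · simp [hin, Ne.symm hin]

theorem exists_finset_sum_eq_digitVal (hb : 3 ≤ b) (hk : IsExpanding b k) {c : ℕ →₀ ℤ}
    (hc : ∀ i, |c i| ≤ 1) {J : Set ℤ} (hJ : ∀ n : ℕ, c n ≠ 0 → c n * ((n : ℤ) + 1) ∈ J) :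
    ∃ F : Finset ℤ, ↑F ⊆ k '' J ∧ digitVal (fun n : ℕ => k (n + 1)) c = ∑ x ∈ F, x := by
  have hpos : ∀ n : ℕ, 0 < k (n + 1) := pos_of_growth (hk.growth hb)
  have hunit : ∀ n, c n ≠ 0 → c n = 1 ∨ c n = -1 := fun n hn => by
    have := abs_le.1 (hc n)
    omega
  refine ⟨c.support.image fun n : ℕ => c n * k (n + 1), fun x hx => ?_, ?_⟩
  · obtain ⟨n, hn, rfl⟩ := Finset.mem_image.1 (Finset.mem_coe.1 hx)
    have hn' := Finsupp.mem_support_iff.1 hn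
    refine ⟨_, hJ n hn', ?_⟩
    rcases hunit n hn' with h | h
    · simp [h]
    · rw [h, neg_one_mul, neg_one_mul, hk.1]
  · rw [Finset.sum_image, digitVal, Finsupp.linearCombination_apply]
    · rfl
    · intro m hm n hn hmn
      have habs : ∀ i, c i ≠ 0 → |c i * k (i + 1)| = k (i + 1) := fun i hi => by
        rw [abs_mul, abs_of_pos (hpos i)]
        rcases hunit i hi with h | h <;> simp [h]
      refine (hk.strictMono hb).injective ?_
      rw [← habs m (Finsupp.mem_support_iff.1 hm), ← habs n (Finsupp.mem_support_iff.1 hn)]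
      exact congrArg abs hmn

theorem setA_eq_digitSums (hb : 3 ≤ b) (hk : IsExpanding b k) {lab : ℕ → ℕ} {R : ℤ → ℕ →₀ ℕ}
    (hR : LengthVecSpec k lab R) (M : Set (ℕ →₀ ℕ)) :
    setA k R M = digitSums (fun n : ℕ => k (n + 1)) (fun n => lab (n + 1)) {a | |a| ≤ 1} M := by
  ext t
  constructor
  · rintro ⟨⟨F, hF, rfl⟩, hM⟩
    obtain ⟨c, hc, hv⟩ := exists_digits_of_sum hb hk F hF
    have hc1 : ∀ i, |c i| ≤ 1 := fun i => by
      rw [hc]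
      split_ifs <;> simp
    refine ⟨c, hc1, ?_, hv⟩
    rwa [← lengthVec_digitVal hk hR hc1, hv]
  · rintro ⟨c, hc, hm, rfl⟩
    obtain ⟨F, hF, hv⟩ := exists_finset_sum_eq_digitVal hb hk hc (J := Set.univ) fun _ _ => trivial
    refine ⟨⟨F, by rwa [← Set.image_univ], hv⟩, ?_⟩
    rwa [lengthVec_digitVal hk hR hc]

theorem setAP_eq_digitSums (hb : 3 ≤ b) (hk : IsExpanding b k) {lab : ℕ → ℕ} {R : ℤ → ℕ →₀ ℕ}
    (hR : LengthVecSpec k lab R) (M : Set (ℕ →₀ ℕ)) :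
    setAP k R M =
      digitSums (fun n : ℕ => k (n + 1)) (fun n => lab (n + 1)) {a | 0 ≤ a ∧ |a| ≤ 1} M := by
  have hpos : ∀ n : ℕ, 0 < k (n + 1) := pos_of_growth (hk.growth hb)
  ext t
  constructor
  · rintro ⟨⟨-, hM⟩, F, hF, rfl⟩
    obtain ⟨c, hc, hv⟩ := exists_digits_of_sum hb hk F (hF.trans (Set.image_subset_range _ _))
    have hneg : ∀ i : ℕ, -k (i + 1) ∉ F := fun i hi => by
      obtain ⟨j, hj : 0 < j, hkj⟩ := hF hi
      obtain ⟨n, rfl⟩ : ∃ n : ℕ, j = (n : ℤ) + 1 := ⟨(j - 1).toNat, by omega⟩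
      linarith [hpos i, hpos n]
    have hc1 : ∀ i, 0 ≤ c i ∧ |c i| ≤ 1 := fun i => by
      rw [hc, if_neg (hneg i)]
      split_ifs <;> simp
    refine ⟨c, hc1, ?_, hv⟩
    rwa [← lengthVec_digitVal hk hR fun i => (hc1 i).2, hv]
  · rintro ⟨c, hc, hm, rfl⟩
    obtain ⟨F, hF, hv⟩ := exists_finset_sum_eq_digitVal hb hk (fun i => (hc i).2)
      (J := {j | 0 < j}) fun n hn => mul_pos (lt_of_le_of_ne (hc n).1 (Ne.symm hn)) (by positivity)
    refine ⟨⟨⟨F, hF.trans (Set.image_subset_range _ _), hv⟩, ?_⟩, F, hF, hv⟩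
    rwa [lengthVec_digitVal hk hR fun i => (hc i).2]

theorem PartitionSpec.frequently {D : ℕ → Set ℕ} {lab : ℕ → ℕ} (hD : PartitionSpec D lab)
    (ℓ : ℕ) : ∃ᶠ n in atTop, lab (n + 1) = ℓ := by
  rw [Filter.frequently_atTop]
  intro a
  obtain ⟨n, hn, han⟩ := (hD.1 ℓ).exists_gt a
  refine ⟨n - 1, by omega, ?_⟩
  rw [Nat.sub_add_cancel (by omega)]
  by_contra hne
  exact (Set.eq_empty_iff_forall_notMem.1 (hD.2.1 _ _ hne) n) ⟨hD.2.2 n, hn⟩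

end Bridge

/-- With the standing labeled-subshift setup: if `𝓜` is not of finite type then `X(𝓜)` and
`X₊(𝓜)` contain non-periodic recurrent points; if `𝓜` is of finite type then `e = χ(∅)` is
the only recurrent point of `X(𝓜)` and `X₊(𝓜)`, and these subshifts are topologically
transitive, locally equicontinuous, and (if `𝓜 ≠ ∅`) not weakly mixing. -/
theorem stmt18 (b : ℕ) (hb : 3 ≤ b) (k : ℤ → ℤ) (hk : IsExpanding b k)
    (hk1 : (b : ℤ) + 1 < k 1)
    (D : ℕ → Set ℕ) (lab : ℕ → ℕ) (hD : PartitionSpec D lab)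
    (R : ℤ → ℕ →₀ ℕ) (hR : LengthVecSpec k lab R)
    (M : Set (ℕ →₀ ℕ)) (hM : IsLabel M) :
    (¬ FiniteType M →
      (∃ x ∈ XM k R M, RecPt x ∧ ¬ PerPt x) ∧ (∃ x ∈ XMP k R M, RecPt x ∧ ¬ PerPt x)) ∧
    (FiniteType M →
      ((fun _ : ℤ => false) ∈ XM k R M ∧ (fun _ : ℤ => false) ∈ XMP k R M ∧
        (∀ x ∈ XM k R M, (RecPt x ↔ x = fun _ : ℤ => false)) ∧
        (∀ x ∈ XMP k R M, (RecPt x ↔ x = fun _ : ℤ => false))) ∧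
      TopTransOn (XM k R M) ∧ TopTransOn (XMP k R M) ∧
      LEOn (XM k R M) ∧ LEOn (XMP k R M) ∧
      (M.Nonempty → ¬ WeakMixOn (XM k R M) ∧ ¬ WeakMixOn (XMP k R M))) := by
  have hK := hk.growth hb
  have hL := hD.frequently
  simp only [XM, XMP, xL, xLP, setA_eq_digitSums hb hk hR, setAP_eq_digitSums hb hk hR]
  have h0 : (0 : ℤ) ∈ {a : ℤ | |a| ≤ 1} := by simp
  have h1 : (1 : ℤ) ∈ {a : ℤ | |a| ≤ 1} := by simp
  have hle : ∀ a ∈ {a : ℤ | |a| ≤ 1}, |a| ≤ 1 := fun _ h => h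
  have h0' : (0 : ℤ) ∈ {a : ℤ | 0 ≤ a ∧ |a| ≤ 1} := by simp
  have h1' : (1 : ℤ) ∈ {a : ℤ | 0 ≤ a ∧ |a| ≤ 1} := by simp
  have hle' : ∀ a ∈ {a : ℤ | 0 ≤ a ∧ |a| ≤ 1}, |a| ≤ 1 := fun _ h => h.2
  refine ⟨fun hft => ⟨exists_recPt_not_perPt hK hL h0 h1 hle hM hft,
    exists_recPt_not_perPt hK hL h0' h1' hle' hM hft⟩, fun hft => ⟨⟨?_, ?_, ?_, ?_⟩, ?_⟩⟩
  · exact false_mem_orbitClosure hK hle M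
  · exact false_mem_orbitClosure hK hle' M
  · exact fun _ hx => recPt_iff_of_finiteType hK h0 hle hM hft hx
  · exact fun _ hx => recPt_iff_of_finiteType hK h0' hle' hM hft hx
  · exact ⟨topTransOn_orbitClosure _, topTransOn_orbitClosure _,
      leOn_of_finiteType hK h0 hle hM hft, leOn_of_finiteType hK h0' hle' hM hft, fun hne =>
      ⟨not_weakMixOn_of_not_recPt (not_recPt_chiB_digitSums hK h0 hle hM hft hne),
        not_weakMixOn_of_not_recPt (not_recPt_chiB_digitSums hK h0' hle' hM hft hne)⟩⟩
end

section
/- With the standing labeled-subshift setup, if 𝓜 is a finitary label, then X(𝓜) and X₊(𝓜) are countable sets, and the subshifts (X(𝓜),S) and (X₊(𝓜),S) are WAP; moreover their enveloping semigroups E(X(𝓜),S) and E(X₊(𝓜),S) are abelian. -/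
open Filter Topology

/-- A label is bounded if some `μ : ℕ → ℕ` dominates all its elements pointwise. -/
def BoundedLabel (M : Set (ℕ →₀ ℕ)) : Prop :=
  ∃ μ : ℕ → ℕ, ∀ m ∈ M, ∀ ℓ : ℕ, m ℓ ≤ μ ℓ

/-- `Supp 𝓜 = {supp m : m ∈ 𝓜}`. -/
def SuppM (M : Set (ℕ →₀ ℕ)) : Set (Set ℕ) :=
  (fun m : ℕ →₀ ℕ => (m.support : Set ℕ)) '' M

/-- A label is finitary: it is bounded, and for every sequence `(Sᵢ)` of finite subsets of `ℕ`
with `⋃ᵢ Sᵢ` infinite, there are only finitely many `T ⊆ ℕ` with `T ∪ Sᵢ ∈ Supp 𝓜` for all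
sufficiently large `i`. -/
def Finitary (M : Set (ℕ →₀ ℕ)) : Prop :=
  BoundedLabel M ∧
  ∀ S : ℕ → Set ℕ, (∀ i, (S i).Finite) → (⋃ i, S i).Infinite →
    {T : Set ℕ | ∃ I : ℕ, ∀ i : ℕ, I ≤ i → T ∪ S i ∈ SuppM M}.Finite

open Classical in
/-- The restriction of `Sⁿ` to a (shift-invariant) subset `Z`. -/
noncomputable def restShift (Z : Set (ℤ → Bool)) (n : ℤ) : ↥Z → ↥Z :=
  fun x => if h : shiftZ n x.1 ∈ Z then ⟨shiftZ n x.1, h⟩ else x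

/-- The enveloping semigroup `E(Z,S)` of the subshift on `Z`: the closure of
`{Sⁿ|_Z : n ∈ ℤ}` in `Z → Z` with the product (pointwise convergence) topology. -/
noncomputable def EnvZ (Z : Set (ℤ → Bool)) : Set (↥Z → ↥Z) :=
  closure (Set.range (restShift Z))


theorem exists_ultrafilter_tendsto_of_mem_closure_range {ι X : Type*} [TopologicalSpace X]
    {f : ι → X} {y : X} (h : y ∈ closure (Set.range f)) :
    ∃ U : Ultrafilter ι, Tendsto f U (𝓝 y) := by
  obtain ⟨u, hu, huy⟩ := mem_closure_iff_ultrafilter.1 h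
  have : NeBot (comap f (u : Filter X)) := u.neBot.comap_of_range_mem hu
  exact ⟨Ultrafilter.of _, (tendsto_comap.mono_left (Ultrafilter.of_le _)).mono_right huy⟩

theorem Ultrafilter.eventually_apply_eq_true_iff_of_tendsto {ι α : Type*} {U : Ultrafilter ι}
    {f : ι → α → Bool} {y : α → Bool} (h : Tendsto f U (𝓝 y)) (a : α) :
    y a = true ↔ ∀ᶠ i in U, f i a = true := by
  have h1 := tendsto_pi_nhds.1 h a
  rw [nhds_discrete, tendsto_pure] at h1
  constructor
  · intro ha
    filter_upwards [h1] with i hi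
    rw [hi, ha]
  · intro ha
    obtain ⟨i, hi, hi'⟩ := (h1.and ha).exists
    rw [← hi, hi']

/-- The double limit condition along ultrafilters for a point of `{0,1}^ℤ`. -/
def DoubleLimit (x : ℤ → Bool) : Prop :=
  ∀ U V : Ultrafilter ℤ, (∀ᶠ s in V, ∀ᶠ t in U, x (s + t) = true) →
    ∀ᶠ t in U, ∀ᶠ s in V, x (s + t) = true

theorem DoubleLimit.swap {x : ℤ → Bool} (hx : DoubleLimit x) (U V : Ultrafilter ℤ) (n : ℤ) :
    (∀ᶠ s in V, ∀ᶠ t in U, x (n + s + t) = true) ↔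
      ∀ᶠ t in U, ∀ᶠ s in V, x (n + s + t) = true := by
  constructor
  · intro h
    have := hx U (V.map (n + ·)) (by simpa using h)
    simpa using this
  · intro h
    have := hx V (U.map (n + ·)) (by simpa [add_right_comm] using h)
    simpa [add_right_comm] using this

theorem shiftZ_mem_orbitClosure {x z : ℤ → Bool} (n : ℤ) (hz : z ∈ orbitClosure x) :
    shiftZ n z ∈ orbitClosure x := by
  have hc : Continuous (shiftZ n) := continuous_pi fun s => continuous_apply (s + n)
  refine map_mem_closure hc hz ?_
  rintro _ ⟨m, rfl⟩
  exact ⟨m + n, by funext s; simp only [shiftZ]; congr 1; ring⟩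

theorem exists_ultrafilter_of_mem_orbitClosure {x z : ℤ → Bool} (hz : z ∈ orbitClosure x) :
    ∃ U : Ultrafilter ℤ, ∀ n, z n = true ↔ ∀ᶠ t in U, x (n + t) = true := by
  obtain ⟨U, hU⟩ := exists_ultrafilter_tendsto_of_mem_closure_range hz
  exact ⟨U, Ultrafilter.eventually_apply_eq_true_iff_of_tendsto hU⟩

theorem exists_ultrafilter_of_mem_envZ {x : ℤ → Bool}
    {p : ↥(orbitClosure x) → ↥(orbitClosure x)} (hp : p ∈ EnvZ (orbitClosure x)) :
    ∃ U : Ultrafilter ℤ, ∀ z n, (p z).1 n = true ↔ ∀ᶠ t in U, z.1 (n + t) = true := by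
  obtain ⟨U, hU⟩ := exists_ultrafilter_tendsto_of_mem_closure_range hp
  refine ⟨U, fun z => ?_⟩
  have h1 := (continuous_subtype_val.tendsto (p z)).comp (tendsto_pi_nhds.1 hU z)
  have h2 := Ultrafilter.eventually_apply_eq_true_iff_of_tendsto h1
  intro n
  rw [h2 n]
  simp [restShift, shiftZ_mem_orbitClosure _ z.2, shiftZ]

theorem DoubleLimit.comp_comm {x : ℤ → Bool} (hx : DoubleLimit x)
    {p q : ↥(orbitClosure x) → ↥(orbitClosure x)} (hp : p ∈ EnvZ (orbitClosure x))
    (hq : q ∈ EnvZ (orbitClosure x)) : p ∘ q = q ∘ p := by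
  obtain ⟨P, hP⟩ := exists_ultrafilter_of_mem_envZ hp
  obtain ⟨Q, hQ⟩ := exists_ultrafilter_of_mem_envZ hq
  funext z
  obtain ⟨W, hW⟩ := exists_ultrafilter_of_mem_orbitClosure z.2
  refine Subtype.ext (funext fun n => ?_)
  rw [Bool.eq_iff_iff]
  simp only [Function.comp_apply, hP, hQ, hW]
  have h1 := hx.swap (Q.bind fun s => W.map (s + ·)) P n
  simp only [Ultrafilter.bind, Ultrafilter.coe_map] at h1
  have h1 : (∀ᶠ t in P, ∀ᶠ s in Q, ∀ᶠ r in W, x (n + t + (s + r)) = true) ↔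
      ∀ᶠ s in Q, ∀ᶠ r in W, ∀ᶠ t in P, x (n + t + (s + r)) = true := h1
  simp only [← add_assoc] at h1
  rw [h1]
  refine eventually_congr (Eventually.of_forall fun s => ?_)
  have h2 := hx.swap W P (n + s)
  simp only [add_right_comm _ _ s] at h2 ⊢
  exact h2.symm

theorem DoubleLimit.continuous {x : ℤ → Bool} (hx : DoubleLimit x)
    {p : ↥(orbitClosure x) → ↥(orbitClosure x)} (hp : p ∈ EnvZ (orbitClosure x)) :
    Continuous p := by
  obtain ⟨P, hP⟩ := exists_ultrafilter_of_mem_envZ hp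
  choose U hU using fun y : ↥(orbitClosure x) => exists_ultrafilter_of_mem_orbitClosure y.2
  rw [continuous_iff_ultrafilter]
  intro z g hg
  have hz := Ultrafilter.eventually_apply_eq_true_iff_of_tendsto
    ((continuous_subtype_val.tendsto z).mono_left hg)
  rw [tendsto_subtype_rng, tendsto_pi_nhds]
  intro n
  have key : (p z).1 n = true ↔ ∀ᶠ y in g, (p y).1 n = true := by
    have h1 := hx.swap (g.bind U) P n
    have h1 : (∀ᶠ t in P, ∀ᶠ y in g, ∀ᶠ s in U y, x (n + t + s) = true) ↔
      ∀ᶠ y in g, ∀ᶠ s in U y, ∀ᶠ t in P, x (n + t + s) = true := h1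
    simp only [← hU, ← hz, ← hP, ← hx.swap] at h1
    exact h1
  rw [nhds_discrete, tendsto_pure]
  cases h : (p z).1 n
  · rw [h] at key
    simpa using key
  · exact key.1 h

theorem Ultrafilter.finite_setOf_eventually_add_mem {M : Set (ℕ →₀ ℕ)} (hfin : Finitary M)
    (P : Ultrafilter (ℕ →₀ ℕ)) (hP : ∀ᶠ r in P, r ∈ M) :
    (∃ r, P = pure r) ∨ {w | ∀ᶠ r in P, w + r ∈ M}.Finite := by
  obtain ⟨⟨μ, hμ⟩, hT⟩ := hfin
  by_cases hF : ∃ F : Finset ℕ, ∀ᶠ r : ℕ →₀ ℕ in P, r.support ⊆ F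
  · left
    obtain ⟨F, hF⟩ := hF
    have hfinset : {r : ℕ →₀ ℕ | r ≤ Finsupp.indicator F fun i _ => μ i}.Finite :=
      Set.finite_Iic _
    obtain ⟨r, -, hr⟩ := P.eq_pure_of_finite_mem hfinset (by
      filter_upwards [hP, hF] with r hr hrF
      intro i
      by_cases hi : i ∈ F
      · simpa [Finsupp.indicator_apply, hi] using hμ r hr i
      · have : r i = 0 := by
          by_contra h
          exact hi (hrF (Finsupp.mem_support_iff.2 h))
        simp [this])
    exact ⟨r, hr⟩
  · right
    push Not at hF
    set L := {w : ℕ →₀ ℕ | ∀ᶠ r in P, w + r ∈ M} with hL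
    by_contra hinf
    have hLμ : ∀ w ∈ L, ∀ i, w i ≤ μ i := by
      intro w hw i
      obtain ⟨r, hr⟩ := Eventually.exists hw
      exact (Nat.le_add_right _ _).trans (hμ _ hr i)
    have hsupp : ((fun w : ℕ →₀ ℕ => w.support) '' L).Infinite := by
      intro hfs
      refine hinf (hfs.of_finite_fibers _ fun F _ => ?_)
      refine (Set.finite_Iic (Finsupp.indicator F fun i _ => μ i)).subset ?_
      rintro w ⟨hw, hwF⟩
      intro i
      by_cases hi : i ∈ F
      · simpa [Finsupp.indicator_apply, hi] using hLμ w hw i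
      · have : w i = 0 := by
          by_contra h
          exact hi (hwF ▸ Finsupp.mem_support_iff.2 h)
        simp [this]
    let w : ℕ → Finset ℕ := fun n => (hsupp.natEmbedding _ n).1
    have hw : ∀ n, ∃ v ∈ L, v.support = w n := fun n => (hsupp.natEmbedding _ n).2
    choose v hvL hv using hw
    have step : ∀ (n : ℕ) (F : Finset ℕ), ∃ r : ℕ →₀ ℕ,
        (∀ i ≤ n, v i + r ∈ M) ∧ ¬ r.support ⊆ F := by
      intro n F
      have h1 : ∀ᶠ r in P, ∀ i ∈ Set.Iic n, v i + r ∈ M :=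
        (eventually_all_finite (Set.finite_Iic n)).2 fun i _ => hvL i
      exact (h1.and (hF F)).exists
    choose ρ hρM hρF using step
    -- a union of supports built so that each new support leaves the previous union
    obtain ⟨G, hG0, hG⟩ : ∃ G : ℕ → Finset ℕ,
        G 0 = ∅ ∧ ∀ n, G (n + 1) = G n ∪ (ρ n (G n)).support :=
      ⟨fun n => Nat.rec ∅ (fun n F => F ∪ (ρ n F).support) n, rfl, fun n => rfl⟩
    have hGsub : ∀ n, (G n : Set ℕ) ⊆ ⋃ i, ((ρ i (G i)).support : Set ℕ) := by
      intro n
      induction n with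
      | zero => simp [hG0]
      | succ n ih =>
        rw [hG, Finset.coe_union]
        exact Set.union_subset ih (Set.subset_iUnion
          (fun i => ((ρ i (G i)).support : Set ℕ)) n)
    have hGlt : StrictMono G := strictMono_nat_of_lt_succ fun n => by
      rw [hG]
      refine lt_of_le_of_ne Finset.subset_union_left fun h => hρF n (G n) ?_
      exact Finset.subset_union_right.trans h.symm.subset
    have hU : (⋃ i, ((ρ i (G i)).support : Set ℕ)).Infinite := by
      intro hfU
      refine Set.infinite_range_of_injective hGlt.injective
        ((hfU.toFinset.powerset.finite_toSet).subset ?_)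
      rintro _ ⟨n, rfl⟩
      simpa [Finset.subset_iff, Set.subset_def] using hGsub n
    refine Set.infinite_range_of_injective
      (f := fun n => (w n : Set ℕ)) ?_ ((hT _ (fun i => Finset.finite_toSet _) hU).subset ?_)
    · intro a c h
      exact (hsupp.natEmbedding _).injective (Subtype.ext (Finset.coe_injective h))
    · rintro _ ⟨n, rfl⟩
      refine ⟨n, fun i hi => ⟨v n + ρ i (G i), hρM i _ n hi, ?_⟩⟩
      ext a
      have := congrArg (a ∈ ·) (hv n)
      simp only [Finsupp.mem_support_iff, eq_iff_iff] at this
      simp only [Finset.mem_coe, Finsupp.mem_support_iff, Finsupp.add_apply, Set.mem_union,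
        ← this]
      omega

theorem Ultrafilter.eventually_swap_add_mem {M : Set (ℕ →₀ ℕ)} (hM : IsLabel M)
    (hfin : Finitary M) (P Q : Ultrafilter (ℕ →₀ ℕ)) (w : ℕ →₀ ℕ)
    (h : ∀ᶠ p in P, ∀ᶠ q in Q, w + p + q ∈ M) : ∀ᶠ q in Q, ∀ᶠ p in P, w + p + q ∈ M := by
  have hQ : ∀ᶠ q in Q, q ∈ M := by
    obtain ⟨p, hp⟩ := h.exists
    filter_upwards [hp] with q hq using hM _ _ le_add_self hq
  rcases Q.finite_setOf_eventually_add_mem hfin hQ with ⟨r, rfl⟩ | hL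
  · simpa using h
  · obtain ⟨r, -, rfl⟩ := P.eq_pure_of_finite_mem (hL.preimage
      (add_right_injective w).injOn) h
    simpa using h

/-- The length vector of a digit sequence. -/
noncomputable def lengthVec (lab : ℕ → ℕ) (e : ℕ →₀ ℤ) : ℕ →₀ ℕ :=
  ∑ n ∈ e.support, Finsupp.single (lab n) 1

/-- The values of digit sequences with digits in `Sg` whose length vector lies in `M`. -/
def digitSet (K : ℕ → ℤ) (lab : ℕ → ℕ) (Sg : Set ℤ) (M : Set (ℕ →₀ ℕ)) : Set ℤ :=
  {t | ∃ e : ℕ →₀ ℤ, (∀ n, e n ∈ Sg) ∧ digitVal K e = t ∧ lengthVec lab e ∈ M}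

/-- Each term of `K` exceeds three times the sum of its predecessors. -/
def TripleGrowth (K : ℕ → ℤ) : Prop := ∀ n, 3 * ∑ i ∈ Finset.range n, K i < K n

theorem TripleGrowth.pos {K : ℕ → ℤ} (hK : TripleGrowth K) (n : ℕ) : 0 < K n := by
  induction n using Nat.strong_induction_on with
  | _ n ih =>
    have h1 := hK n
    have h2 : 0 ≤ ∑ i ∈ Finset.range n, K i :=
      Finset.sum_nonneg fun i hi => (ih i (Finset.mem_range.1 hi)).le
    omega

theorem TripleGrowth.strictMono {K : ℕ → ℤ} (hK : TripleGrowth K) : StrictMono K := by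
  refine strictMono_nat_of_lt_succ fun n => ?_
  have h1 := hK (n + 1)
  rw [Finset.sum_range_succ] at h1
  have h2 : 0 ≤ ∑ i ∈ Finset.range n, K i := Finset.sum_nonneg fun i _ => (hK.pos i).le
  have := hK.pos n
  omega

theorem TripleGrowth.lt_apply {K : ℕ → ℤ} (hK : TripleGrowth K) (n : ℕ) : (n : ℤ) < K n := by
  induction n with
  | zero => exact hK.pos 0
  | succ n ih =>
    have := hK.strictMono (Nat.lt_add_one n)
    push_cast
    omega

theorem TripleGrowth.lt_of_apply_ne_zero {K : ℕ → ℤ} (hK : TripleGrowth K) {f : ℕ →₀ ℤ}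
    (hf : ∀ n, |f n| ≤ 2) {n : ℕ} (hn : f n ≠ 0) : (n : ℤ) < 3 * |digitVal K f| := by
  have hne : f.support.Nonempty := ⟨n, Finsupp.mem_support_iff.2 hn⟩
  set m := f.support.max' hne with hm
  have hmf : f m ≠ 0 := Finsupp.mem_support_iff.1 (f.support.max'_mem hne)
  have hnm : n ≤ m := f.support.le_max' n (Finsupp.mem_support_iff.2 hn)
  have hsum : digitVal K f = ∑ i ∈ Finset.range m, f i * K i + f m * K m := by
    rw [← Finset.sum_range_succ, digitVal, Finsupp.linearCombination_apply, Finsupp.sum]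
    refine Finset.sum_subset (fun i hi => ?_) (fun i _ hi => ?_)
    · exact Finset.mem_range_succ_iff.2 (f.support.le_max' i hi)
    · simp [Finsupp.notMem_support_iff.1 hi]
  have hlow : |∑ i ∈ Finset.range m, f i * K i| ≤ 2 * ∑ i ∈ Finset.range m, K i := by
    rw [Finset.mul_sum]
    refine (Finset.abs_sum_le_sum_abs _ _).trans (Finset.sum_le_sum fun i _ => ?_)
    rw [abs_mul, abs_of_pos (hK.pos i)]
    exact mul_le_mul_of_nonneg_right (hf i) (hK.pos i).le
  have htop : K m ≤ |f m * K m| := by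
    rw [abs_mul, abs_of_pos (hK.pos m)]
    exact le_mul_of_one_le_left (hK.pos m).le (Int.one_le_abs hmf)
  have htri : |f m * K m| ≤ |digitVal K f| + |∑ i ∈ Finset.range m, f i * K i| := by
    have : f m * K m = digitVal K f - ∑ i ∈ Finset.range m, f i * K i := by rw [hsum]; ring
    rw [this]
    exact abs_sub _ _
  have h3 := hK m
  have h4 := hK.lt_apply m
  omega

theorem TripleGrowth.digitVal_inj {K : ℕ → ℤ} (hK : TripleGrowth K) {Sg : Set ℤ}
    (hSg : ∀ c ∈ Sg, |c| ≤ 1) {d e : ℕ →₀ ℤ} (hd : ∀ n, d n ∈ Sg) (he : ∀ n, e n ∈ Sg)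
    (h : digitVal K d = digitVal K e) : d = e := by
  ext n
  by_contra hn
  have h1 := hK.lt_of_apply_ne_zero (f := d - e) (n := n) (fun i => by
    have := abs_sub (d i) (e i)
    have := hSg _ (hd i)
    have := hSg _ (he i)
    rw [Finsupp.sub_apply]
    omega) (by rwa [Finsupp.sub_apply, sub_ne_zero])
  rw [map_sub, h, sub_self, abs_zero] at h1
  omega

theorem lengthVec_add_of_disjoint (lab : ℕ → ℕ) {d e : ℕ →₀ ℤ}
    (h : Disjoint d.support e.support) :
    lengthVec lab (d + e) = lengthVec lab d + lengthVec lab e := by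
  rw [lengthVec, Finsupp.support_add_eq h, Finset.sum_union h, lengthVec, lengthVec]

theorem lengthVec_mono (lab : ℕ → ℕ) {d e : ℕ →₀ ℤ} (h : d.support ⊆ e.support) :
    lengthVec lab d ≤ lengthVec lab e :=
  Finset.sum_le_sum_of_subset h

theorem coe_support_lengthVec (lab : ℕ → ℕ) (e : ℕ →₀ ℤ) :
    ((lengthVec lab e).support : Set ℕ) = lab '' e.support := by
  ext a
  simp [lengthVec, Finsupp.single_apply, Finset.card_eq_zero,
    Finset.filter_eq_empty_iff, Finsupp.finsetSum_apply]

theorem lengthVec_apply (lab : ℕ → ℕ) (e : ℕ →₀ ℤ) (a : ℕ) :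
    lengthVec lab e a = (e.support.filter fun n => lab n = a).card := by
  simp [lengthVec, Finsupp.single_apply, Finsupp.finsetSum_apply]

/-- An ultrafilter on digit sequences whose digits escape to infinity. -/
def Escaping (W : Ultrafilter (ℕ →₀ ℤ)) : Prop := ∀ N, ∀ᶠ e : ℕ →₀ ℤ in W, ∀ n < N, e n = 0

theorem Escaping.eventually_add {W : Ultrafilter (ℕ →₀ ℤ)} (hW : Escaping W) {Sg : Set ℤ}
    (hWg : ∀ᶠ e : ℕ →₀ ℤ in W, ∀ n, e n ∈ Sg) (lab : ℕ → ℕ) {d : ℕ →₀ ℤ} (hd : ∀ n, d n ∈ Sg) :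
    ∀ᶠ e in W, (∀ n, (d + e) n ∈ Sg) ∧
      lengthVec lab (d + e) = lengthVec lab d + lengthVec lab e := by
  filter_upwards [hW (d.support.sup id + 1), hWg] with e he heg
  have hde : ∀ n, d n = 0 ∨ e n = 0 := by
    intro n
    by_contra! hn
    exact hn.2 (he n (Nat.lt_succ_of_le
      (Finset.le_sup (f := id) (Finsupp.mem_support_iff.2 hn.1))))
  refine ⟨fun n => ?_, lengthVec_add_of_disjoint lab ?_⟩
  · rcases hde n with h | h
    · simpa [h] using heg n
    · simpa [h] using hd n
  · rw [Finset.disjoint_left]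
    intro n h1 h2
    rw [Finsupp.mem_support_iff] at h1 h2
    exact (hde n).elim h1 h2

theorem Escaping.eventually_split {W : Ultrafilter (ℕ →₀ ℤ)} (hW : Escaping W)
    {K : ℕ → ℤ} (hK : TripleGrowth K) {Sg : Set ℤ} (hSg : ∀ c ∈ Sg, |c| ≤ 1) (h0 : 0 ∈ Sg)
    (hWg : ∀ᶠ e : ℕ →₀ ℤ in W, ∀ n, e n ∈ Sg) (lab : ℕ → ℕ) (s : ℤ) :
    ∀ᶠ e in W, ∀ t : ℕ →₀ ℤ, (∀ n, t n ∈ Sg) → digitVal K t = s + digitVal K e →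
      ∃ d : ℕ →₀ ℤ, (∀ n, d n ∈ Sg) ∧ digitVal K d = s ∧
        lengthVec lab t = lengthVec lab d + lengthVec lab e := by
  filter_upwards [hW (3 * s.natAbs), hWg] with e he heg t ht hts
  have hval : digitVal K (t - e) = s := by rw [map_sub, hts, add_sub_cancel_right]
  have hsupp : ∀ n, t n - e n = 0 ∨ e n = 0 := by
    intro n
    by_contra! hn
    have h1 := hK.lt_of_apply_ne_zero (f := t - e) (n := n) (fun i => by
      have := abs_sub (t i) (e i)
      have := hSg _ (ht i)
      have := hSg _ (heg i)
      rw [Finsupp.sub_apply]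
      omega) (by rw [Finsupp.sub_apply]; exact hn.1)
    rw [hval, Int.abs_eq_natAbs] at h1
    exact hn.2 (he n (by omega))
  refine ⟨t - e, fun n => ?_, hval, ?_⟩
  · rcases hsupp n with h | h
    · rwa [Finsupp.sub_apply, h]
    · simpa [h] using ht n
  · rw [← lengthVec_add_of_disjoint, sub_add_cancel]
    rw [Finset.disjoint_left]
    intro n h1 h2
    rw [Finsupp.mem_support_iff] at h1 h2
    exact (hsupp n).elim h1 h2

theorem Escaping.eventually_mem_digitSet_iff {W : Ultrafilter (ℕ →₀ ℤ)} (hW : Escaping W)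
    {K : ℕ → ℤ} (hK : TripleGrowth K) {Sg : Set ℤ} (hSg : ∀ c ∈ Sg, |c| ≤ 1) (h0 : 0 ∈ Sg)
    (hWg : ∀ᶠ e : ℕ →₀ ℤ in W, ∀ n, e n ∈ Sg) (lab : ℕ → ℕ) (M : Set (ℕ →₀ ℕ)) (s : ℤ) :
    (∀ᶠ e in W, s + digitVal K e ∈ digitSet K lab Sg M) ↔
      s ∈ digitSet K lab Sg {w | ∀ᶠ e in W, w + lengthVec lab e ∈ M} := by
  constructor
  · intro h
    have h1 := h.and (hW.eventually_split hK hSg h0 hWg lab s)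
    obtain ⟨e, ⟨t, htg, ht, htM⟩, hsplit⟩ := h1.exists
    obtain ⟨d, hd, hds, -⟩ := hsplit t htg ht
    refine ⟨d, hd, hds, ?_⟩
    filter_upwards [h1] with e ⟨⟨t, htg, ht, htM⟩, hsplit⟩
    obtain ⟨d', hd', hds', hv⟩ := hsplit t htg ht
    rwa [hK.digitVal_inj hSg hd hd' (hds.trans hds'.symm), ← hv]
  · rintro ⟨d, hd, rfl, hdM⟩
    filter_upwards [hdM, hW.eventually_add hWg lab hd] with e he ⟨hg, hv⟩
    exact ⟨d + e, hg, map_add _ _ _, hv ▸ he⟩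

theorem exists_digit_limit_s19 {W : Ultrafilter (ℕ →₀ ℤ)} {lab : ℕ → ℕ}
    {Sg : Set ℤ} (hSg : ∀ c ∈ Sg, |c| ≤ 1) (hWg : ∀ᶠ e : ℕ →₀ ℤ in W, ∀ n, e n ∈ Sg)
    {M : Set (ℕ →₀ ℕ)} (hM : IsLabel M) (hfin : Finitary M)
    (hWM : ∀ᶠ e in W, lengthVec lab e ∈ M) :
    ∃ ε : ℕ →₀ ℤ, ∀ n, ∀ᶠ e : ℕ →₀ ℤ in W, e n = ε n := by
  have hlim : ∀ n, ∃ c, ∀ᶠ e : ℕ →₀ ℤ in W, e n = c := by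
    intro n
    obtain ⟨c, -, hc⟩ := (W.map fun e => e n).eq_pure_of_finite_mem
      (Set.finite_Icc (-1 : ℤ) 1) (hWg.mono fun e he => abs_le.1 (hSg _ (he n)))
    refine ⟨c, ?_⟩
    have : ({c} : Set ℤ) ∈ W.map fun e => e n := by rw [hc]; exact Ultrafilter.mem_pure.2 rfl
    exact this
  choose ε hε using hlim
  have hsub : ∀ F : Finset ℕ, (∀ n ∈ F, ε n ≠ 0) →
      lengthVec lab (Finsupp.indicator F fun _ _ => 1) ∈ M := by
    intro F hF
    obtain ⟨e, heM, he⟩ := (hWM.and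
      ((eventually_all_finset F).2 fun n _ => hε n)).exists
    refine hM _ _ (lengthVec_mono lab fun n hn => ?_) heM
    have hnF := Finsupp.support_indicator_subset _ _ hn
    rw [Finsupp.mem_support_iff, he n hnF]
    exact hF n hnF
  have hsuppF : ∀ F : Finset ℕ,
      (Finsupp.indicator F fun _ _ => (1 : ℤ)).support = F := by
    intro F
    ext n
    simp [Finsupp.indicator_apply]
  have hfinI : {n | ε n ≠ 0}.Finite := by
    by_contra hinf
    obtain ⟨⟨μ, hμ⟩, hT⟩ := hfin
    have hlabinf : (lab '' {n | ε n ≠ 0}).Infinite := by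
      intro hl
      refine hinf (hl.of_finite_fibers _ fun a _ => ?_)
      by_contra hfib
      obtain ⟨F, hF, hcard⟩ := Set.Infinite.exists_subset_card_eq hfib (μ a + 1)
      have h1 := hμ _ (hsub F fun n hn => (hF hn).1) a
      rw [lengthVec_apply, hsuppF, Finset.filter_true_of_mem (show ∀ n ∈ F, lab n = a from fun n hn => (hF hn).2)] at h1
      omega
    classical
    let S : ℕ → Finset ℕ := fun i => (Finset.range i).filter fun n => ε n ≠ 0
    have hU : (⋃ i, lab '' (S i : Set ℕ)) = lab '' {n | ε n ≠ 0} := by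
      rw [← Set.image_iUnion]
      congr 1
      ext n
      simp only [S, Set.mem_iUnion, Finset.coe_filter, Finset.mem_range, Set.mem_ofPred_eq]
      exact ⟨fun ⟨i, h⟩ => h.2, fun h => ⟨n + 1, Nat.lt_succ_self n, h⟩⟩
    have hfT := hT (fun i => lab '' (S i : Set ℕ)) (fun i => (Finset.finite_toSet _).image _)
      (hU ▸ hlabinf)
    refine hlabinf.image (f := fun a => ({a} : Set ℕ)) Set.singleton_injective.injOn
      (hfT.subset ?_)
    rintro _ ⟨_, ⟨n, hn, rfl⟩, rfl⟩
    refine ⟨0, fun i _ => ⟨_, hsub (insert n (S i)) ?_, ?_⟩⟩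
    · intro m hm
      rcases Finset.mem_insert.1 hm with rfl | hm
      · exact hn
      · exact (Finset.mem_filter.1 hm).2
    · simp only [coe_support_lengthVec, hsuppF, Finset.coe_insert, Set.image_insert_eq,
        Set.singleton_union]
  exact ⟨Finsupp.ofSupportFinite ε hfinI, hε⟩

theorem exists_escaping {K : ℕ → ℤ} {lab : ℕ → ℕ}
    {Sg : Set ℤ} (hSg : ∀ c ∈ Sg, |c| ≤ 1) (h0 : 0 ∈ Sg)
    {M : Set (ℕ →₀ ℕ)} (hM : IsLabel M) (hfin : Finitary M)
    (U : Ultrafilter ℤ) (hU : ∀ᶠ t in U, t ∈ digitSet K lab Sg M) :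
    ∃ (a : ℤ) (W : Ultrafilter (ℕ →₀ ℤ)), U = W.map (fun e => a + digitVal K e) ∧
      Escaping W ∧ (∀ᶠ e : ℕ →₀ ℤ in W, ∀ n, e n ∈ Sg) ∧ ∀ᶠ e in W, lengthVec lab e ∈ M := by
  have hex : ∀ t : ℤ, ∃ e : ℕ →₀ ℤ, t ∈ digitSet K lab Sg M →
      (∀ n, e n ∈ Sg) ∧ digitVal K e = t ∧ lengthVec lab e ∈ M := by
    intro t
    by_cases ht : t ∈ digitSet K lab Sg M
    · obtain ⟨e, he⟩ := ht
      exact ⟨e, fun _ => he⟩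
    · exact ⟨0, fun h => absurd h ht⟩
  choose g hg using hex
  have hg1 : ∀ᶠ e : ℕ →₀ ℤ in U.map g, ∀ n, e n ∈ Sg := hU.mono fun t ht => (hg t ht).1
  have hg3 : ∀ᶠ e in U.map g, lengthVec lab e ∈ M := hU.mono fun t ht => (hg t ht).2.2
  obtain ⟨ε, hε⟩ := exists_digit_limit_s19 hSg hg1 hM hfin hg3
  have hεs : ∀ᶠ e : ℕ →₀ ℤ in U.map g, ∀ n ∈ ε.support, e n = ε n :=
    (eventually_all_finset _).2 fun n _ => hε n
  have hdig : ∀ {e : ℕ →₀ ℤ}, (∀ n ∈ ε.support, e n = ε n) → ∀ n,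
      (e - ε) n = 0 ∨ (e - ε) n = e n := by
    intro e he n
    by_cases hn : n ∈ ε.support
    · simp [he n hn]
    · simp [Finsupp.notMem_support_iff.1 hn]
  refine ⟨digitVal K ε, (U.map g).map (· - ε), ?_, ?_, ?_, ?_⟩
  · rw [Ultrafilter.map_map, Ultrafilter.map_map]
    refine Ultrafilter.coe_injective ?_
    rw [Ultrafilter.coe_map]
    refine (Filter.map_id.symm.trans (Filter.map_congr ?_))
    filter_upwards [hU] with t ht
    simp [(hg t ht).2.1]
  · intro N
    have : ∀ᶠ e : ℕ →₀ ℤ in U.map g, ∀ n ∈ Finset.range N, e n = ε n :=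
      (eventually_all_finset _).2 fun n _ => hε n
    rw [Ultrafilter.coe_map, eventually_map]
    filter_upwards [this] with e he n hn
    simp [he n (Finset.mem_range.2 hn)]
  · rw [Ultrafilter.coe_map, eventually_map]
    filter_upwards [hεs.and hg1] with e he n
    rcases hdig he.1 n with h | h
    · simpa only [h] using h0
    · simpa only [h] using he.2 n
  · rw [Ultrafilter.coe_map, eventually_map]
    filter_upwards [hεs.and hg3] with e he
    refine hM _ _ (lengthVec_mono lab fun n hn => ?_) he.2
    rw [Finsupp.mem_support_iff] at hn ⊢
    rcases hdig he.1 n with h | h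
    · exact absurd h hn
    · rwa [← h]

section DigitSets

variable {K : ℕ → ℤ} {lab : ℕ → ℕ} {Sg : Set ℤ} {M : Set (ℕ →₀ ℕ)}

theorem exists_escaping_eventually_add_mem_iff (hK : TripleGrowth K)
    (hSg : ∀ c ∈ Sg, |c| ≤ 1) (h0 : 0 ∈ Sg) (hM : IsLabel M) (hfin : Finitary M)
    (U : Ultrafilter ℤ) {s : ℤ} (hU : ∀ᶠ t in U, s + t ∈ digitSet K lab Sg M) :
    ∃ (c : ℤ) (W : Ultrafilter (ℕ →₀ ℤ)), U = W.map (fun e => -c + digitVal K e) ∧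
      Escaping W ∧ (∀ᶠ e : ℕ →₀ ℤ in W, ∀ n, e n ∈ Sg) ∧
      (∀ᶠ e in W, lengthVec lab e ∈ M) ∧
      ∀ r, (∀ᶠ t in U, r + t ∈ digitSet K lab Sg M) ↔
        r - c ∈ digitSet K lab Sg {w | ∀ᶠ e in W, w + lengthVec lab e ∈ M} := by
  obtain ⟨a, W, hUW, hW, hg, hWM⟩ := exists_escaping hSg h0 hM hfin (U.map (s + ·)) hU
  have hUW' : U = W.map (fun e => -(s - a) + digitVal K e) := by
    have := congrArg (Ultrafilter.map (-s + ·)) hUW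
    rw [Ultrafilter.map_map, Ultrafilter.map_map] at this
    simpa [Function.comp_def, add_assoc, neg_sub, sub_eq_neg_add] using this
  refine ⟨s - a, W, hUW', hW, hg, hWM, fun r => ?_⟩
  rw [← hW.eventually_mem_digitSet_iff hK hSg h0 hg, hUW']
  simp only [Ultrafilter.coe_map, eventually_map, ← add_assoc, ← sub_eq_add_neg]

theorem doubleLimit_digitSet (hK : TripleGrowth K)
    (hSg : ∀ c ∈ Sg, |c| ≤ 1) (h0 : 0 ∈ Sg) (hM : IsLabel M) (hfin : Finitary M) :
    DoubleLimit (chiB (digitSet K lab Sg M)) := by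
  intro U V h
  simp only [chiB, decide_eq_true_eq] at h ⊢
  obtain ⟨s₀, hs₀⟩ := h.exists
  obtain ⟨c, W, rfl, hW, hWg, hWM, hiff⟩ :=
    exists_escaping_eventually_add_mem_iff hK hSg h0 hM hfin U hs₀
  simp only [hiff] at h
  have hV : ∀ᶠ s in V, -c + s ∈ digitSet K lab Sg M := by
    filter_upwards [h] with s hs
    obtain ⟨d, hd, hds, hdM⟩ := hs
    obtain ⟨e, he⟩ := hdM.exists
    exact ⟨d, hd, by rw [hds]; ring, hM _ _ le_self_add he⟩
  obtain ⟨c', W', rfl, hW', hWg', hWM', -⟩ :=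
    exists_escaping_eventually_add_mem_iff hK hSg h0 hM hfin V hV
  simp only [Ultrafilter.coe_map, eventually_map] at h ⊢
  have h' : ∀ᶠ e in W', (-c' - c) + digitVal K e ∈
      digitSet K lab Sg {w | ∀ᶠ e in W, w + lengthVec lab e ∈ M} := by
    filter_upwards [h] with e he
    convert he using 1
    ring
  rw [hW'.eventually_mem_digitSet_iff hK hSg h0 hWg'] at h'
  obtain ⟨d, hd, hdc, hdM⟩ := h'
  have hsw := Ultrafilter.eventually_swap_add_mem hM hfin (W'.map (lengthVec lab))
    (W.map (lengthVec lab)) (lengthVec lab d) hdM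
  simp only [Ultrafilter.coe_map, eventually_map] at hsw
  filter_upwards [hsw, hW.eventually_add hWg lab hd] with e he ⟨hdg, hde⟩
  filter_upwards [he, hW'.eventually_add hWg' lab hdg] with e' he' ⟨hg', hv'⟩
  refine ⟨d + e + e', hg', ?_, ?_⟩
  · rw [map_add, map_add, hdc]
    ring
  · rwa [hv', hde, add_right_comm]

theorem countable_orbitClosure_digitSet (hK : TripleGrowth K)
    (hSg : ∀ c ∈ Sg, |c| ≤ 1) (h0 : 0 ∈ Sg) (hM : IsLabel M) (hfin : Finitary M) :
    (orbitClosure (chiB (digitSet K lab Sg M))).Countable := by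
  let 𝓛 : Set (Set (ℕ →₀ ℕ)) := Set.range (Msub M) ∪ {L | L.Finite}
  have h𝓛 : 𝓛.Countable := (Set.countable_range _).union Set.Countable.ofPred_finite
  have hc : ((fun q : ℤ × Set (ℕ →₀ ℕ) => chiB {n | n - q.1 ∈ digitSet K lab Sg q.2}) ''
      (Set.univ ×ˢ 𝓛)).Countable := (Set.countable_univ.prod h𝓛).image _
  refine (hc.union (Set.countable_singleton fun _ => false)).mono fun y hy => ?_
  obtain ⟨U, hU⟩ := exists_ultrafilter_of_mem_orbitClosure hy
  by_cases hy0 : ∃ n, y n = true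
  · left
    obtain ⟨s, hs⟩ := hy0
    simp only [chiB, decide_eq_true_eq] at hU
    obtain ⟨c, W, -, hW, hWg, hWM, hiff⟩ :=
      exists_escaping_eventually_add_mem_iff hK hSg h0 hM hfin U ((hU s).1 hs)
    refine ⟨(c, {w | ∀ᶠ e in W, w + lengthVec lab e ∈ M}), ⟨Set.mem_univ _, ?_⟩, ?_⟩
    · rcases (W.map (lengthVec lab)).finite_setOf_eventually_add_mem hfin hWM with ⟨r, hr⟩ | hL
      · left
        refine ⟨r, Set.ext fun w => ?_⟩
        change w + r ∈ M ↔ ∀ᶠ r in W.map (lengthVec lab), w + r ∈ M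
        rw [hr]
        simp
      · exact Or.inr hL
    · funext n
      rw [Bool.eq_iff_iff, hU, hiff]
      simp [chiB]
  · right
    push Not at hy0
    exact funext fun n => by simpa using hy0 n

end DigitSets

/-- The sequence of positive generators of an expanding function. -/
def posTerm (k : ℤ → ℤ) (n : ℕ) : ℤ := k ((n : ℤ) + 1)

section Expanding

variable {b : ℕ} {k : ℤ → ℤ}

theorem IsExpanding.tripleGrowth (hb : 3 ≤ b) (hk : IsExpanding b k) :
    TripleGrowth (posTerm k) := by
  have hsum : ∀ n : ℕ, ∑ i ∈ Finset.range (n + 1), k (i : ℤ) =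
      ∑ i ∈ Finset.range n, posTerm k i := by
    intro n
    rw [Finset.sum_range_succ']
    simp [posTerm, hk.map_zero]
  have hlt : ∀ n : ℕ, (b : ℤ) * ∑ i ∈ Finset.range n, posTerm k i < posTerm k n := by
    intro n
    rw [← hsum]
    exact hk.2 n
  have hnonneg : ∀ n : ℕ, 0 ≤ ∑ i ∈ Finset.range n, posTerm k i := by
    intro n
    induction n with
    | zero => simp
    | succ n ih =>
      rw [Finset.sum_range_succ]
      have := hlt n
      have : 0 ≤ (b : ℤ) * ∑ i ∈ Finset.range n, posTerm k i := by positivity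
      omega
  intro n
  refine lt_of_le_of_lt ?_ (hlt n)
  exact mul_le_mul_of_nonneg_right (by exact_mod_cast hb) (hnonneg n)

theorem IsExpanding.apply_digit_mul (hk : IsExpanding b k) {c : ℤ} (hc : |c| ≤ 1) (n : ℕ) :
    k (c * ((n : ℤ) + 1)) = c * posTerm k n := by
  have : c = 0 ∨ c = 1 ∨ c = -1 := by rw [abs_le] at hc; omega
  rcases this with rfl | rfl | rfl
  · simp [hk.map_zero]
  · simp [posTerm]
  · rw [neg_one_mul, hk.1, neg_one_mul, posTerm]

theorem IsExpanding.lengthVec_eq (hk : IsExpanding b k) {lab : ℕ → ℕ} {R : ℤ → ℕ →₀ ℕ}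
    (hR : LengthVecSpec k lab R) {e : ℕ →₀ ℤ} (he : ∀ n, |e n| ≤ 1) :
    R (digitVal (posTerm k) e) = lengthVec (fun n => lab (n + 1)) e := by
  let o : Fin e.support.card ≃ e.support :=
    Fin.revPerm.trans (e.support.orderIsoOfFin rfl).toEquiv
  have habs : ∀ n ∈ e.support, |e n * ((n : ℤ) + 1)| = n + 1 := by
    intro n hn
    have h1 := Int.one_le_abs (Finsupp.mem_support_iff.1 hn)
    rw [abs_mul, le_antisymm (he n) h1, one_mul, abs_of_pos (by omega)]
  have hsum : ∀ {α : Type} [AddCommMonoid α] (f : ℕ → α),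
      ∑ i, f (o i).1 = ∑ n ∈ e.support, f n := by
    intro α _ f
    rw [o.sum_comp (fun n : e.support => f n.1), Finset.sum_coe_sort e.support f]
  have hexp : IsExpansion k (digitVal (posTerm k) e) e.support.card
      fun i => e (o i).1 * (((o i).1 : ℤ) + 1) := by
    refine ⟨fun i => ?_, fun i₁ i₂ hi => ?_, ?_⟩
    · exact mul_ne_zero (Finsupp.mem_support_iff.1 (o i).2) (by omega)
    · rw [habs _ (o i₁).2, habs _ (o i₂).2]
      have : o i₂ < o i₁ := (e.support.orderIsoOfFin rfl).strictMono (Fin.rev_lt_rev.2 hi)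
      have : (o i₂).1 < (o i₁).1 := this
      omega
    · simp only [hk.apply_digit_mul (he _)]
      rw [hsum fun n => e n * posTerm k n]
      rfl
  rw [hR _ _ _ hexp, lengthVec, ← hsum]
  refine Finset.sum_congr rfl fun i _ => ?_
  have : (e (o i).1 * (((o i).1 : ℤ) + 1)).natAbs = (o i).1 + 1 := by
    zify
    exact habs _ (o i).2
  rw [this]

theorem IsExpanding.exists_finset_sum_eq_digitVal (hb : 3 ≤ b) (hk : IsExpanding b k)
    {e : ℕ →₀ ℤ} (he : ∀ n, |e n| ≤ 1) :
    ∃ F : Finset ℤ, (∀ x ∈ F, ∃ n ∈ e.support, x = k (e n * ((n : ℤ) + 1))) ∧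
      digitVal (posTerm k) e = ∑ x ∈ F, x := by
  have hK := hk.tripleGrowth hb
  have habs : ∀ n ∈ e.support, |e n * posTerm k n| = posTerm k n := by
    intro n hn
    have h1 := Int.one_le_abs (Finsupp.mem_support_iff.1 hn)
    rw [abs_mul, le_antisymm (he n) h1, one_mul, abs_of_pos (hK.pos n)]
  refine ⟨e.support.image fun n => e n * posTerm k n, ?_, ?_⟩
  · intro x hx
    obtain ⟨n, hn, rfl⟩ := Finset.mem_image.1 hx
    exact ⟨n, hn, (hk.apply_digit_mul (he n) n).symm⟩
  · rw [Finset.sum_image]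
    · rfl
    · intro m hm n hn h
      have h := congrArg abs h
      simp only [habs m hm, habs n hn] at h
      exact hK.strictMono.injective h

theorem IsExpanding.exists_digitVal_eq_sum (hb : 3 ≤ b) (hk : IsExpanding b k)
    {F : Finset ℤ} (hF : (F : Set ℤ) ⊆ Set.range k) :
    ∃ e : ℕ →₀ ℤ, digitVal (posTerm k) e = ∑ x ∈ F, x ∧
      ∀ n, e n = (if posTerm k n ∈ F then 1 else 0) - (if -posTerm k n ∈ F then 1 else 0) := by
  have hK := hk.tripleGrowth hb
  have hex : ∀ x ∈ Set.range k, ∃ g : ℕ →₀ ℤ, digitVal (posTerm k) g = x ∧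
      ∀ n, g n = (if posTerm k n = x then 1 else 0) - (if -posTerm k n = x then 1 else 0) := by
    rintro _ ⟨j, rfl⟩
    obtain ⟨n, rfl | rfl⟩ := j.eq_nat_or_neg
    · rcases n with _ | n
      · refine ⟨0, by simp [hk.map_zero], fun n => ?_⟩
        have := hK.pos n
        simp [hk.map_zero, this.ne']
      · refine ⟨Finsupp.single n 1, by simp [digitVal, posTerm], fun m => ?_⟩
        have h1 := hK.pos n
        have h2 := hK.pos m
        have h3 : k ((n + 1 : ℕ) : ℤ) = posTerm k n := by simp [posTerm]
        rw [h3, if_neg (by omega : ¬ -posTerm k m = posTerm k n), Finsupp.single_apply]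
        simp [hK.strictMono.injective.eq_iff, eq_comm]
    · rcases n with _ | n
      · refine ⟨0, by simp [hk.map_zero], fun n => ?_⟩
        have := hK.pos n
        simp [hk.map_zero, this.ne']
      · have h3 : k (-((n + 1 : ℕ) : ℤ)) = -posTerm k n := by rw [hk.1]; simp [posTerm]
        refine ⟨Finsupp.single n (-1), by rw [h3]; simp [digitVal], fun m => ?_⟩
        have h1 := hK.pos n
        have h2 := hK.pos m
        rw [h3, if_neg (by omega : ¬ posTerm k m = -posTerm k n), Finsupp.single_apply]
        simp only [neg_inj, hK.strictMono.injective.eq_iff, eq_comm (a := m)]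
        split_ifs <;> simp
  choose! g hg1 hg2 using hex
  refine ⟨∑ x ∈ F, g x, ?_, fun n => ?_⟩
  · rw [map_sum]
    exact Finset.sum_congr rfl fun x hx => hg1 x (hF hx)
  · rw [Finsupp.finsetSum_apply, Finset.sum_congr rfl fun x hx => hg2 x (hF hx) n,
      Finset.sum_sub_distrib, Finset.sum_ite_eq, Finset.sum_ite_eq]

theorem IsExpanding.setA_eq (hb : 3 ≤ b) (hk : IsExpanding b k) {lab : ℕ → ℕ}
    {R : ℤ → ℕ →₀ ℕ} (hR : LengthVecSpec k lab R) (M : Set (ℕ →₀ ℕ)) :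
    setA k R M = digitSet (posTerm k) (fun n => lab (n + 1)) {c | |c| ≤ 1} M := by
  ext t
  constructor
  · rintro ⟨⟨F, hF, rfl⟩, hRM⟩
    obtain ⟨e, he, hen⟩ := hk.exists_digitVal_eq_sum hb hF
    have hdig : ∀ n, |e n| ≤ 1 := by
      intro n
      rw [hen]
      split_ifs <;> simp
    exact ⟨e, hdig, he, by rwa [← hk.lengthVec_eq hR hdig, he]⟩
  · rintro ⟨e, he, rfl, hM⟩
    obtain ⟨F, hF, hsum⟩ := hk.exists_finset_sum_eq_digitVal hb he
    refine ⟨⟨F, fun x hx => ?_, hsum⟩, by rwa [hk.lengthVec_eq hR he]⟩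
    obtain ⟨n, -, rfl⟩ := hF x hx
    exact Set.mem_range_self _

theorem IsExpanding.setAP_eq (hb : 3 ≤ b) (hk : IsExpanding b k) {lab : ℕ → ℕ}
    {R : ℤ → ℕ →₀ ℕ} (hR : LengthVecSpec k lab R) (M : Set (ℕ →₀ ℕ)) :
    setAP k R M = digitSet (posTerm k) (fun n => lab (n + 1)) {0, 1} M := by
  have hK := hk.tripleGrowth hb
  have hsub : ∀ {e : ℕ →₀ ℤ}, (∀ n, e n ∈ ({0, 1} : Set ℤ)) → ∀ n, |e n| ≤ 1 := by
    intro e he n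
    have h : e n = 0 ∨ e n = 1 := he n
    rcases h with h | h <;> simp [h]
  ext t
  constructor
  · rintro ⟨⟨-, hRM⟩, F, hF, rfl⟩
    obtain ⟨e, he, hen⟩ := hk.exists_digitVal_eq_sum hb (hF.trans (Set.image_subset_range _ _))
    have hneg : ∀ n, -posTerm k n ∉ F := by
      intro n hn
      obtain ⟨j, hj, hjn⟩ := hF hn
      obtain ⟨m, rfl⟩ : ∃ m : ℕ, j = m + 1 := ⟨(j - 1).toNat, by
        have : 0 < j := hj
        omega⟩
      have h1 := hK.pos n
      have h2 : 0 < k (m + 1) := hK.pos m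
      omega
    have hdig : ∀ n, e n ∈ ({0, 1} : Set ℤ) := by
      intro n
      rw [hen, if_neg (hneg n)]
      split_ifs <;> simp
    exact ⟨e, hdig, he, by rwa [← hk.lengthVec_eq hR (hsub hdig), he]⟩
  · rintro ⟨e, he, rfl, hM⟩
    refine ⟨?_, ?_⟩
    · rw [hk.setA_eq hb hR]
      exact ⟨e, hsub he, rfl, hM⟩
    · obtain ⟨F, hF, hsum⟩ := hk.exists_finset_sum_eq_digitVal hb (hsub he)
      refine ⟨F, fun x hx => ?_, hsum⟩
      obtain ⟨n, hn, rfl⟩ := hF x hx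
      refine ⟨_, ?_, rfl⟩
      have h1 : e n = 1 := (he n).resolve_left (Finsupp.mem_support_iff.1 hn)
      rw [h1, Set.mem_ofPred_eq]
      omega

end Expanding

/-- With the standing labeled-subshift setup: for a finitary label `𝓜`, the subshifts
`X(𝓜)` and `X₊(𝓜)` are countable and WAP (every element of the enveloping semigroup is
continuous), and their enveloping semigroups are abelian. -/
theorem stmt19 (b : ℕ) (hb : 3 ≤ b) (k : ℤ → ℤ) (hk : IsExpanding b k)
    (hk1 : (b : ℤ) + 1 < k 1)
    (D : ℕ → Set ℕ) (lab : ℕ → ℕ) (hD : PartitionSpec D lab)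
    (R : ℤ → ℕ →₀ ℕ) (hR : LengthVecSpec k lab R)
    (M : Set (ℕ →₀ ℕ)) (hM : IsLabel M) (hfin : Finitary M) :
    (XM k R M).Countable ∧ (XMP k R M).Countable ∧
    (∀ p ∈ EnvZ (XM k R M), Continuous p) ∧
    (∀ p ∈ EnvZ (XMP k R M), Continuous p) ∧
    (∀ p ∈ EnvZ (XM k R M), ∀ q ∈ EnvZ (XM k R M), p ∘ q = q ∘ p) ∧
    (∀ p ∈ EnvZ (XMP k R M), ∀ q ∈ EnvZ (XMP k R M), p ∘ q = q ∘ p) := by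
  have hK := hk.tripleGrowth hb
  have h2 : ∀ c ∈ ({0, 1} : Set ℤ), |c| ≤ 1 := by
    rintro c (rfl | rfl) <;> simp
  have hx := doubleLimit_digitSet (lab := fun n => lab (n + 1)) hK (Sg := {c | |c| ≤ 1})
    (fun _ h => h) (by simp) hM hfin
  have hxP := doubleLimit_digitSet (lab := fun n => lab (n + 1)) hK h2 (by simp) hM hfin
  rw [XM, XMP, xL, xLP, hk.setA_eq hb hR, hk.setAP_eq hb hR]
  exact ⟨countable_orbitClosure_digitSet hK (fun _ h => h) (by simp) hM hfin,
    countable_orbitClosure_digitSet hK h2 (by simp) hM hfin,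
    fun p hp => hx.continuous hp, fun p hp => hxP.continuous hp,
    fun p hp q hq => hx.comp_comm hp hq, fun p hp q hq => hxP.comp_comm hp hq⟩
end
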